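/- Spatial behaviour for subcritical exponents: let N ≥ 3, let m ∈ (0, m_s], and let u be a radial energy solution of the fast diffusion equation with exponent m and extinction time T > 0. Then for every fixed t ∈ (0,T) there exist constants c₁ > 0 and c₂ > 0 (depending on t) such that c₁ e^{−(N−1)r/m} ≤ u(r,t) ≤ c₂ e^{−(N−1)r/m} for all r ≥ 0. -/

import Mathlib

open MeasureTheory Set Filter Topology

/-- Membership in the radial energy space `H¹_rad` on hyperbolic space `ℍ^N`:
`v` is locally absolutely continuous on `(0,∞)` (expressed via the fundamental theorem
of calculus for its a.e. derivative) and both `v` and `v'` are square-integrable with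
respect to the weight `(sinh s)^(N-1)`. -/
def MemH1rad (N : ℕ) (v : ℝ → ℝ) : Prop :=
  (∀ a b : ℝ, 0 < a → a ≤ b → v b - v a = ∫ s in a..b, deriv v s) ∧
  MeasureTheory.IntegrableOn (fun s => (v s) ^ 2 * Real.sinh s ^ (N - 1)) (Set.Ioi 0) ∧
  MeasureTheory.IntegrableOn (fun s => (deriv v s) ^ 2 * Real.sinh s ^ (N - 1)) (Set.Ioi 0)

/-- The squared `H¹` norm `‖v‖_2² + ‖v'‖_2²` with weight `(sinh s)^(N-1)`. -/
noncomputable def H1normSq (N : ℕ) (v : ℝ → ℝ) : ℝ :=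
  (∫ s in Set.Ioi (0:ℝ), (v s) ^ 2 * Real.sinh s ^ (N - 1)) +
  (∫ s in Set.Ioi (0:ℝ), (deriv v s) ^ 2 * Real.sinh s ^ (N - 1))

/-- A radial energy solution of the fast diffusion equation `u_t = Δ(u^m)` on `ℍ^N`,
with exponent `m`, extinction time `T` (initial datum `u(·,0)`). -/
structure IsRadialEnergySolution (N : ℕ) (m T : ℝ) (u : ℝ → ℝ → ℝ) : Prop where
  continuousOn : ContinuousOn (fun p : ℝ × ℝ => u p.1 p.2) (Set.Ici 0 ×ˢ Set.Icc 0 T)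
  nonneg : ∀ r ∈ Set.Ici (0:ℝ), ∀ t ∈ Set.Icc (0:ℝ) T, 0 ≤ u r t
  smooth : ContDiffOn ℝ (⊤ : ℕ∞) (fun p : ℝ × ℝ => u p.1 p.2) (Set.Ici 0 ×ˢ Set.Ioo 0 T)
  pos : ∀ r ∈ Set.Ici (0:ℝ), ∀ t ∈ Set.Ioo (0:ℝ) T, 0 < u r t
  pde : ∀ r > (0:ℝ), ∀ t ∈ Set.Ioo (0:ℝ) T,
    deriv (fun τ => u r τ) t
      = deriv (deriv (fun ρ => u ρ t ^ m)) r
        + ((N : ℝ) - 1) * (Real.cosh r / Real.sinh r) * deriv (fun ρ => u ρ t ^ m) r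
  neumann : ∀ t ∈ Set.Ioo (0:ℝ) T, deriv (fun ρ => u ρ t ^ m) 0 = 0
  extinction : ∀ r ∈ Set.Ici (0:ℝ), u r T = 0
  energy : ∀ t ∈ Set.Ioo (0:ℝ) T, MemH1rad N (fun ρ => u ρ t ^ m)
  energy_bdd : ∀ ε ∈ Set.Ioo (0:ℝ) T, ∃ C : ℝ, ∀ t ∈ Set.Ico ε T,
    H1normSq N (fun ρ => u ρ t ^ m) ≤ C
  init_bdd : ∃ M : ℝ, ∀ r ∈ Set.Ici (0:ℝ), u r 0 ≤ M
  init_nonzero : ∃ r ∈ Set.Ici (0:ℝ), u r 0 ≠ 0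
  init_energy : MemH1rad N (fun ρ => u ρ 0 ^ m)


lemma pos_part_ftc (f f' : ℝ → ℝ) {a b : ℝ} (hab : a ≤ b)
    (hf : ∀ x ∈ Icc a b, HasDerivAt f (f' x) x) (hf' : ContinuousOn f' (Icc a b)) :
    max (f b) 0 - max (f a) 0 = ∫ x in a..b, (if 0 < f x then f' x else 0) := by
  obtain ⟨K, hK⟩ := isCompact_Icc.exists_bound_of_continuousOn hf'
  have hL : LipschitzOnWith (Real.toNNReal K) f (Icc a b) := by
    apply Convex.lipschitzOnWith_of_nnnorm_hasDerivWithin_le (f' := f') (convex_Icc a b)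
      (fun x hx => (hf x hx).hasDerivWithinAt)
    intro x hx
    rw [← NNReal.coe_le_coe, coe_nnnorm]
    exact (hK x hx).trans (Real.le_coe_toNNReal K)
  have hL2 : LipschitzOnWith (Real.toNNReal K) (fun x => max (f x) 0) (uIcc a b) := by
    rw [uIcc_of_le hab]
    intro x hx y hy
    refine le_trans ?_ (hL hx hy)
    rw [edist_dist, edist_dist]
    apply ENNReal.ofReal_le_ofReal
    rw [Real.dist_eq, Real.dist_eq]
    simpa using abs_max_sub_max_le_abs (f x) (f y) 0
  have hAC := hL2.absolutelyContinuousOnInterval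
  have hae := hAC.ae_differentiableAt
  rw [← hAC.integral_deriv_eq_sub]
  apply intervalIntegral.integral_congr_ae
  filter_upwards [hae] with x hx hx2
  have hx3 : x ∈ uIcc a b := uIoc_subset_uIcc hx2
  have hd := hx hx3
  rw [uIcc_of_le hab] at hx3
  have hc := (hf x hx3).continuousAt
  rcases lt_trichotomy (f x) 0 with h | h | h
  · rw [if_neg h.not_gt]
    have : (fun x => max (f x) 0) =ᶠ[𝓝 x] fun _ => 0 := by
      filter_upwards [hc.eventually_lt continuousAt_const h] with y hy
      exact max_eq_right hy.le
    rw [this.deriv_eq]; simp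
  · rw [if_neg (by simp [h])]
    apply IsLocalMin.deriv_eq_zero
    filter_upwards with y
    simp [h]
  · rw [if_pos h]
    have : (fun x => max (f x) 0) =ᶠ[𝓝 x] f := by
      filter_upwards [continuousAt_const.eventually_lt hc h] with y hy
      exact max_eq_left hy.le
    rw [this.deriv_eq, (hf x hx3).deriv]

lemma hasDerivAt_maxsq (x : ℝ) : HasDerivAt (fun x : ℝ => (max x 0) ^ 2) (2 * max x 0) x := by
  rcases lt_trichotomy x 0 with h | h | h
  · have : (fun x : ℝ => (max x 0) ^ 2) =ᶠ[𝓝 x] fun _ => 0 := by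
      filter_upwards [gt_mem_nhds h] with y hy
      simp [max_eq_right (le_of_lt hy)]
    rw [max_eq_right h.le]
    simpa using (hasDerivAt_const x (0:ℝ)).congr_of_eventuallyEq this
  · subst h
    rw [hasDerivAt_iff_isLittleO]
    have h1 : (fun x : ℝ => x ^ 2) =o[𝓝 0] fun x => x := by
      simpa using Asymptotics.isLittleO_pow_id (𝕜 := ℝ) (n := 2) (by norm_num)
    simp only [max_self, mul_zero, smul_zero, sub_zero]
    refine Asymptotics.IsBigO.trans_isLittleO ?_ h1
    apply Asymptotics.IsBigO.of_bound 1
    filter_upwards with y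
    rcases le_total y 0 with hy | hy
    · simp [max_eq_right hy]; positivity
    · simp [max_eq_left hy]
  · have : (fun x : ℝ => (max x 0) ^ 2) =ᶠ[𝓝 x] fun x => x ^ 2 := by
      filter_upwards [lt_mem_nhds h] with y hy
      simp [max_eq_left (le_of_lt hy)]
    rw [max_eq_left h.le]
    simpa using (hasDerivAt_pow 2 x).congr_of_eventuallyEq this

/-- regularised sign -/
noncomputable def hk (k x : ℝ) : ℝ := k ^ 2 * (max x 0) ^ 2 / (1 + k ^ 2 * (max x 0) ^ 2)

noncomputable def hk' (k x : ℝ) : ℝ := 2 * k ^ 2 * max x 0 / (1 + k ^ 2 * (max x 0) ^ 2) ^ 2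

lemma hk_deriv (k x : ℝ) : HasDerivAt (hk k) (hk' k x) x := by
  have h1 := (hasDerivAt_maxsq x).const_mul (k ^ 2)
  have h2 := h1.const_add 1
  have hp : 1 + k ^ 2 * (max x 0) ^ 2 ≠ 0 := by positivity
  have := h1.div h2 hp
  refine this.congr_deriv ?_
  unfold hk'
  congr 1
  ring

lemma hk_cont (k : ℝ) : Continuous (hk k) := by
  unfold hk
  refine Continuous.div (by fun_prop) (by fun_prop) (fun x => by positivity)

lemma hk'_cont (k : ℝ) : Continuous (hk' k) := by
  unfold hk'
  refine Continuous.div (by fun_prop) (by fun_prop) (fun x => by positivity)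

lemma hk_nonneg (k x : ℝ) : 0 ≤ hk k x := by unfold hk; positivity

lemma hk_le_one (k x : ℝ) : hk k x ≤ 1 := by
  unfold hk
  rw [div_le_one (by positivity)]
  linarith

lemma hk'_nonneg (k x : ℝ) : 0 ≤ hk' k x := by unfold hk'; positivity

lemma hk'_sq (k x : ℝ) (hk0 : 0 < k) : hk' k x * x ^ 2 ≤ 2 / k := by
  unfold hk'
  rcases le_total x 0 with h | h
  · rw [max_eq_right h]; simp; positivity
  · rw [max_eq_left h, div_mul_eq_mul_div, div_le_div_iff₀ (by positivity) hk0]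
    have hy : 0 ≤ k * x := by positivity
    nlinarith [sq_nonneg (k * x - 1), sq_nonneg ((k*x)^2), mul_nonneg hy (sq_nonneg (k*x-1)), mul_nonneg (sq_nonneg (k*x)) (sq_nonneg (k*x-1)), sq_nonneg (k*x)]

lemma hk_tendsto (x : ℝ) : Tendsto (fun k : ℕ => hk (k : ℝ) x) atTop (𝓝 (if 0 < x then 1 else 0)) := by
  split_ifs with h
  · have h1 : Tendsto (fun k : ℕ => 1 - 1 / (1 + (k:ℝ) ^ 2 * x ^ 2)) atTop (𝓝 (1 - 0)) := by
      apply Tendsto.sub tendsto_const_nhds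
      apply Tendsto.div_atTop tendsto_const_nhds
      apply tendsto_atTop_add_const_left
      apply Tendsto.atTop_mul_const (by positivity)
      exact (tendsto_pow_atTop (by norm_num)).comp tendsto_natCast_atTop_atTop
    rw [sub_zero] at h1
    refine h1.congr (fun k => ?_)
    unfold hk
    rw [max_eq_left h.le]
    field_simp
    ring
  · have : ∀ k : ℕ, hk (k:ℝ) x = 0 := by
      intro k; unfold hk; rw [max_eq_right (not_lt.1 h)]; simp
    simp [this]

lemma kato_abs {R D : ℝ} (hR : 0 ≤ R) (w wr ψ Y Y' : ℝ → ℝ)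
    (hw : ContinuousOn w (Icc 0 R)) (hwr : ContinuousOn wr (Icc 0 R))
    (hdw : ∀ x ∈ Ioo 0 R, HasDerivAt w (wr x) x)
    (hψ0 : ∀ x ∈ Icc 0 R, 0 ≤ ψ x) (hψ1 : ∀ x ∈ Icc 0 R, ψ x ≤ 1)
    (hYe : ∀ x ∈ Icc 0 R, Y x = ψ x * (wr x + D * w x))
    (hY : ContinuousOn Y (Icc 0 R)) (hY' : ContinuousOn Y' (Icc 0 R))
    (hdY : ∀ x ∈ Ioo 0 R, HasDerivAt Y (Y' x) x) (hY0 : Y 0 = 0) :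
    ∫ x in (0:ℝ)..R, (if 0 < w x then Y' x else 0) ≤ |Y R| := by
  have key : ∀ k : ℝ, 0 < k → ∫ x in (0:ℝ)..R, hk k (w x) * Y' x ≤ |Y R| + R * D ^ 2 / k := by
    intro k hk0
    have c1 : ContinuousOn (fun x => hk k (w x)) (Icc 0 R) := (hk_cont k).comp_continuousOn hw
    have c2 : ContinuousOn (fun x => hk' k (w x)) (Icc 0 R) := (hk'_cont k).comp_continuousOn hw
    have i1 : IntervalIntegrable (fun x => hk k (w x) * Y' x) volume 0 R :=
      (c1.mul hY').intervalIntegrable_of_Icc hR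
    have i2 : IntervalIntegrable (fun x => hk' k (w x) * wr x * Y x) volume 0 R :=
      ((c2.mul hwr).mul hY).intervalIntegrable_of_Icc hR
    have ftc := intervalIntegral.integral_eq_sub_of_hasDerivAt_of_le hR (c1.mul hY)
      (f' := fun x => hk' k (w x) * wr x * Y x + hk k (w x) * Y' x)
      (fun x hx => ((hk_deriv k (w x)).comp x (hdw x hx)).mul (hdY x hx)) (i2.add i1)
    rw [intervalIntegral.integral_add i2 i1] at ftc
    have lb : ∫ x in (0:ℝ)..R, -(D ^ 2 / k) ≤ ∫ x in (0:ℝ)..R, hk' k (w x) * wr x * Y x := by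
      apply intervalIntegral.integral_mono_on hR (by simp) i2
      intro x hx
      rw [hYe x hx]
      have a1 := hk'_nonneg k (w x)
      have a2 := hk'_sq k (w x) hk0
      have a3 := hψ0 x hx
      have a4 := hψ1 x hx
      have a5 : -(D^2 * (w x)^2/2) ≤ wr x * (wr x + D * w x) := by
        nlinarith [sq_nonneg (2 * wr x + D * w x), sq_nonneg (D * w x)]
      have a6 : hk' k (w x) * ψ x * (-(D^2 * (w x)^2/2)) ≤ hk' k (w x) * ψ x * (wr x * (wr x + D * w x)) :=
        mul_le_mul_of_nonneg_left a5 (mul_nonneg a1 a3)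
      have a7 : hk' k (w x) * (w x)^2 * ψ x ≤ 2 / k := by
        refine le_trans ?_ a2
        exact mul_le_of_le_one_right (by positivity) a4
      have a8 : D^2 / 2 * (hk' k (w x) * (w x)^2 * ψ x) ≤ D^2/2 * (2/k) :=
        mul_le_mul_of_nonneg_left a7 (by positivity)
      have a9 : D^2/2 * (2/k) = D^2/k := by ring
      rw [a9] at a8
      calc -(D^2/k) ≤ -(D^2 / 2 * (hk' k (w x) * (w x)^2 * ψ x)) := by linarith
        _ = hk' k (w x) * ψ x * (-(D^2 * (w x)^2/2)) := by ring
        _ ≤ _ := a6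
        _ = _ := by ring
    rw [intervalIntegral.integral_const, smul_eq_mul] at lb
    have e1 : hk k (w R) * Y R ≤ |Y R| := by
      calc _ ≤ |hk k (w R) * Y R| := le_abs_self _
        _ = hk k (w R) * |Y R| := by rw [abs_mul, abs_of_nonneg (hk_nonneg _ _)]
        _ ≤ 1 * |Y R| := by gcongr; exact hk_le_one _ _
        _ = _ := one_mul _
    simp only [Pi.mul_apply, hY0, mul_zero, sub_zero] at ftc
    have : R * D^2/k = - ((R - 0) * -(D^2/k)) := by ring
    linarith
  have lim1 : Tendsto (fun k : ℕ => ∫ x in (0:ℝ)..R, hk (k:ℝ) (w x) * Y' x) atTop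
      (𝓝 (∫ x in (0:ℝ)..R, (if 0 < w x then Y' x else 0))) := by
    apply intervalIntegral.tendsto_integral_filter_of_dominated_convergence (fun x => ‖Y' x‖)
    · filter_upwards with k
      have c1 : ContinuousOn (fun x => hk k (w x)) (Icc 0 R) := (hk_cont k).comp_continuousOn hw
      rw [uIoc_of_le hR]
      exact ((c1.mul hY').mono Ioc_subset_Icc_self).aestronglyMeasurable measurableSet_Ioc
    · filter_upwards with k
      filter_upwards with x hx
      rw [norm_mul, Real.norm_of_nonneg (hk_nonneg _ _)]
      exact mul_le_of_le_one_left (norm_nonneg _) (hk_le_one _ _)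
    · exact (hY'.norm).intervalIntegrable_of_Icc hR
    · filter_upwards with x hx
      have := (hk_tendsto (w x)).mul_const (Y' x)
      simpa [ite_mul] using this
  have lim2 : Tendsto (fun k : ℕ => |Y R| + R * D ^ 2 / (k:ℝ)) atTop (𝓝 (|Y R| + 0)) :=
    tendsto_const_nhds.add (tendsto_const_nhds.div_atTop tendsto_natCast_atTop_atTop)
  rw [add_zero] at lim2
  refine le_of_tendsto_of_tendsto lim1 lim2 ?_
  filter_upwards [eventually_gt_atTop 0] with k hk0
  exact key k (by exact_mod_cast hk0)

/-- the weight -/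
noncomputable def psi (n : ℕ) (r : ℝ) : ℝ := Real.exp (-(n:ℝ) * r) * Real.sinh r ^ n

noncomputable def psi' (n : ℕ) (r : ℝ) : ℝ :=
  (n:ℝ) * (Real.exp (-(n:ℝ) * r) * (Real.sinh r ^ (n-1) * Real.cosh r)) - n * psi n r

lemma psi_deriv (n : ℕ) (r : ℝ) : HasDerivAt (psi n) (psi' n r) r := by
  have h1 : HasDerivAt (fun r : ℝ => Real.exp (-(n:ℝ) * r)) (Real.exp (-(n:ℝ) * r) * (-(n:ℝ))) r := by
    have := ((hasDerivAt_id r).const_mul (-(n:ℝ))).exp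
    simpa using this
  have h2 := (Real.hasDerivAt_sinh r).pow n
  refine (h1.mul h2).congr_deriv ?_
  simp only [psi', psi, Pi.pow_apply]; ring

lemma psi_cont (n : ℕ) : Continuous (psi n) := by unfold psi; fun_prop
lemma psi'_cont (n : ℕ) : Continuous (psi' n) := by unfold psi' psi; fun_prop

lemma psi_nonneg (n : ℕ) {r : ℝ} (hr : 0 ≤ r) : 0 ≤ psi n r := by
  have := Real.sinh_nonneg_iff.2 hr
  unfold psi; positivity

lemma psi_pos (n : ℕ) {r : ℝ} (hr : 0 < r) : 0 < psi n r := by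
  have := Real.sinh_pos_iff.2 hr
  unfold psi; positivity

lemma sinh_le_exp (r : ℝ) : Real.sinh r ≤ Real.exp r := by
  rw [Real.sinh_eq]; have := Real.exp_pos r; have := Real.exp_pos (-r); linarith

lemma psi_le_one (n : ℕ) {r : ℝ} (hr : 0 ≤ r) : psi n r ≤ 1 := by
  have h0 := Real.sinh_nonneg_iff.2 hr
  have h : Real.sinh r ^ n ≤ Real.exp r ^ n := pow_le_pow_left₀ h0 (sinh_le_exp r) n
  unfold psi
  calc _ ≤ Real.exp (-(n:ℝ) * r) * Real.exp r ^ n := by gcongr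
    _ = 1 := by rw [← Real.exp_nat_mul, ← Real.exp_add]; simp

lemma psi'_nonneg (n : ℕ) {r : ℝ} (hr : 0 ≤ r) : 0 ≤ psi' n r := by
  have h0 := Real.sinh_nonneg_iff.2 hr
  unfold psi' psi
  rcases Nat.eq_zero_or_pos n with h | h
  · subst h; simp
  · obtain ⟨k, rfl⟩ : ∃ k, n = k + 1 := ⟨n - 1, by omega⟩
    have h1 : Real.sinh r ≤ Real.cosh r := (Real.sinh_lt_cosh r).le
    have h2 : Real.sinh r ^ (k+1) ≤ Real.sinh r ^ k * Real.cosh r := by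
      rw [pow_succ]; gcongr
    have h3 := mul_le_mul_of_nonneg_left h2 (Real.exp_pos (-((k+1:ℕ):ℝ) * r)).le
    have h4 : (0:ℝ) ≤ ((k+1 : ℕ):ℝ) := by positivity
    have := mul_le_mul_of_nonneg_left h3 h4
    simp only [Nat.add_sub_cancel]
    linarith

/-- spatial Kato inequality -/
lemma kato (n : ℕ) (hn : 1 ≤ n) {R : ℝ} (hR : 0 ≤ R) (w wr g : ℝ → ℝ)
    (hw : ContinuousOn w (Icc 0 R)) (hwr : ContinuousOn wr (Icc 0 R))
    (hg : ContinuousOn g (Icc 0 R))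
    (hdw : ∀ x ∈ Ioo 0 R, HasDerivAt w (wr x) x)
    (hdwr : ∀ x ∈ Ioo 0 R, HasDerivAt wr (g x - n * (Real.cosh x / Real.sinh x) * wr x) x) :
    ∫ x in (0:ℝ)..R, (if 0 < w x then g x * psi n x else 0) ≤ |wr R| + n * |w R| := by
  have hpc := psi_cont n
  have hpc' := psi'_cont n
  set Y' : ℝ → ℝ := fun x => g x * psi n x + n * psi' n x * w x with hY'
  have cY' : ContinuousOn Y' (Icc 0 R) := by
    apply ContinuousOn.add
    · exact hg.mul hpc.continuousOn
    · exact ((continuous_const.mul hpc').continuousOn).mul hw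
  have k1 := kato_abs (D := (n:ℝ)) hR w wr (psi n) (fun x => psi n x * (wr x + n * w x)) Y'
    hw hwr hdw (fun x hx => psi_nonneg n hx.1) (fun x hx => psi_le_one n hx.1) (fun x _ => rfl)
    (hpc.continuousOn.mul (hwr.add (continuousOn_const.mul hw))) cY'
    (by
      intro x hx
      refine ((psi_deriv n x).mul ((hdwr x hx).add ((hdw x hx).const_mul (n:ℝ)))).congr_deriv ?_
      have hs : Real.sinh x ≠ 0 := (Real.sinh_pos_iff.2 hx.1).ne'
      obtain ⟨k, rfl⟩ : ∃ k, n = k + 1 := ⟨n - 1, by omega⟩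
      simp only [hY', psi', psi, Nat.add_sub_cancel, Pi.add_apply]
      field_simp
      ring)
    (by simp [psi]; left; omega)
  have k2 : ∫ x in (0:ℝ)..R, (if 0 < w x then g x * psi n x else 0) ≤
      ∫ x in (0:ℝ)..R, (if 0 < w x then Y' x else 0) := by
    have meas : ∀ G : ℝ → ℝ, ContinuousOn G (Icc 0 R) →
        IntervalIntegrable (fun x => if 0 < w x then G x else 0) volume 0 R := by
      intro G hG
      rw [intervalIntegrable_iff_integrableOn_Icc_of_le hR]
      have hs : NullMeasurableSet {x | 0 < w x} (volume.restrict (Icc 0 R)) :=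
        nullMeasurableSet_lt aemeasurable_const (hw.aemeasurable measurableSet_Icc)
      exact Integrable.indicator₀ (hG.integrableOn_compact isCompact_Icc) hs
    apply intervalIntegral.integral_mono_on hR (meas _ (hg.mul hpc.continuousOn)) (meas _ cY')
    intro x hx
    split_ifs with h
    · have := psi'_nonneg n hx.1
      have : (0:ℝ) ≤ n * psi' n x * w x := by positivity
      simp only [hY', Pi.mul_apply]; linarith
    · exact le_rfl
  refine k2.trans (k1.trans ?_)
  rw [abs_mul, abs_of_nonneg (psi_nonneg n hR)]
  refine (mul_le_of_le_one_left (abs_nonneg _) (psi_le_one n hR)).trans ?_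
  refine (abs_add_le _ _).trans ?_
  rw [abs_mul, Nat.abs_cast]

structure Sol (n : ℕ) (m A B C : ℝ) (u vr ut : ℝ → ℝ → ℝ) : Prop where
  cu : ContinuousOn (fun p : ℝ × ℝ => u p.1 p.2) (Ici 0 ×ˢ Ioo A B)
  cut : ContinuousOn (fun p : ℝ × ℝ => ut p.1 p.2) (Ici 0 ×ˢ Ioo A B)
  cvr : ContinuousOn (fun p : ℝ × ℝ => vr p.1 p.2) (Ici 0 ×ˢ Ioo A B)
  pos : ∀ r ∈ Ici (0:ℝ), ∀ t ∈ Ioo A B, 0 < u r t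
  dt : ∀ r ∈ Ici (0:ℝ), ∀ t ∈ Ioo A B, HasDerivAt (fun τ => u r τ) (ut r t) t
  dr : ∀ r > (0:ℝ), ∀ t ∈ Ioo A B, HasDerivAt (fun ρ => u ρ t ^ m) (vr r t) r
  drr : ∀ r > (0:ℝ), ∀ t ∈ Ioo A B, HasDerivAt (fun ρ => vr ρ t)
    (ut r t - n * (Real.cosh r / Real.sinh r) * vr r t) r
  en_int : ∀ t ∈ Ioo A B, IntegrableOn (fun r => ((u r t ^ m) ^ 2 + vr r t ^ 2) * Real.sinh r ^ n)
    (Ioi 0)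
  en_le : ∀ t ∈ Ioo A B, ∫ r in Ioi (0:ℝ), ((u r t ^ m) ^ 2 + vr r t ^ 2) * Real.sinh r ^ n ≤ C

lemma slice_r {g : ℝ → ℝ → ℝ} {A B : ℝ}
    (h : ContinuousOn (fun p : ℝ × ℝ => g p.1 p.2) (Ici 0 ×ˢ Ioo A B)) {t : ℝ} (ht : t ∈ Ioo A B) :
    ContinuousOn (fun r => g r t) (Ici 0) :=
  h.comp (f := fun r : ℝ => (r, t)) (by fun_prop) (fun r hr => ⟨hr, ht⟩)

lemma slice_t {g : ℝ → ℝ → ℝ} {A B : ℝ}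
    (h : ContinuousOn (fun p : ℝ × ℝ => g p.1 p.2) (Ici 0 ×ˢ Ioo A B)) {r : ℝ} (hr : r ∈ Ici (0:ℝ)) :
    ContinuousOn (fun t => g r t) (Ioo A B) :=
  h.comp (f := fun t : ℝ => (r, t)) (by fun_prop) (fun t ht => ⟨hr, ht⟩)

lemma Sol.cv {n : ℕ} {m A B C : ℝ} {u vr ut : ℝ → ℝ → ℝ} (h : Sol n m A B C u vr ut) :
    ContinuousOn (fun p : ℝ × ℝ => u p.1 p.2 ^ m) (Ici 0 ×ˢ Ioo A B) :=
  h.cu.rpow_const (fun p hp => Or.inl (h.pos p.1 hp.1 p.2 hp.2).ne')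

lemma Icc_rect_sub {A B a b t1 t2 : ℝ} (ha : 0 ≤ a) (h1 : A < t1) (h2 : t2 < B) :
    Icc a b ×ˢ Icc t1 t2 ⊆ Ici (0:ℝ) ×ˢ Ioo A B := by
  rintro ⟨r, t⟩ ⟨hr, ht⟩
  exact ⟨ha.trans hr.1, h1.trans_le ht.1, ht.2.trans_lt h2⟩

lemma swap_cont {F : ℝ → ℝ → ℝ} {a b t1 t2 : ℝ} (hab : a ≤ b) (ht : t1 ≤ t2)
    (hF : ContinuousOn (fun p : ℝ × ℝ => F p.1 p.2) (Icc a b ×ˢ Icc t1 t2)) :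
    ∫ r in a..b, ∫ t in t1..t2, F r t = ∫ t in t1..t2, ∫ r in a..b, F r t := by
  apply intervalIntegral_intervalIntegral_swap
  rw [uIoc_of_le hab, uIoc_of_le ht]
  exact (hF.integrableOn_compact (isCompact_Icc.prod isCompact_Icc)).mono_set
    (prod_mono Ioc_subset_Icc_self Ioc_subset_Icc_self)

lemma swap_ite {f F : ℝ → ℝ → ℝ} {a b t1 t2 : ℝ} (hab : a ≤ b) (ht : t1 ≤ t2)
    (hf : ContinuousOn (fun p : ℝ × ℝ => f p.1 p.2) (Icc a b ×ˢ Icc t1 t2))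
    (hF : ContinuousOn (fun p : ℝ × ℝ => F p.1 p.2) (Icc a b ×ˢ Icc t1 t2)) :
    IntegrableOn (fun p : ℝ × ℝ => if 0 < f p.1 p.2 then F p.1 p.2 else 0) (Ioc a b ×ˢ Ioc t1 t2) ∧
    ∫ r in a..b, ∫ t in t1..t2, (if 0 < f r t then F r t else 0) =
      ∫ t in t1..t2, ∫ r in a..b, (if 0 < f r t then F r t else 0) := by
  have hI : IntegrableOn (fun p : ℝ × ℝ => if 0 < f p.1 p.2 then F p.1 p.2 else 0)
      (Icc a b ×ˢ Icc t1 t2) := by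
    have hs : NullMeasurableSet {p : ℝ × ℝ | 0 < f p.1 p.2} (volume.restrict (Icc a b ×ˢ Icc t1 t2)) :=
      nullMeasurableSet_lt aemeasurable_const
        (hf.aemeasurable (measurableSet_Icc.prod measurableSet_Icc))
    exact Integrable.indicator₀ (hF.integrableOn_compact (isCompact_Icc.prod isCompact_Icc)) hs
  have hI2 := hI.mono_set (prod_mono (Ioc_subset_Icc_self (a := a) (b := b))
    (Ioc_subset_Icc_self (a := t1) (b := t2)))
  refine ⟨hI2, ?_⟩
  apply intervalIntegral_intervalIntegral_swap
  rw [uIoc_of_le hab, uIoc_of_le ht]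
  exact hI2

lemma energy_Icc {n : ℕ} {m A B C : ℝ} {u vr ut : ℝ → ℝ → ℝ} (h : Sol n m A B C u vr ut)
    {a b t : ℝ} (ha : 0 < a) (hab : a ≤ b) (ht : t ∈ Ioo A B) :
    Real.sinh a ^ n * ∫ r in a..b, ((u r t ^ m) ^ 2 + vr r t ^ 2) ≤ C := by
  have hsub : Ioc a b ⊆ Ioi (0:ℝ) := fun x hx => ha.trans hx.1
  have hc : ContinuousOn (fun r => ((u r t ^ m) ^ 2 + vr r t ^ 2)) (Icc a b) :=
    (((slice_r (g := fun r t => u r t ^ m) h.cv ht).pow 2).add ((slice_r h.cvr ht).pow 2)).mono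
      (fun x hx => ha.le.trans hx.1)
  rw [← intervalIntegral.integral_const_mul]
  refine le_trans ?_ (h.en_le t ht)
  have h1 : ∫ r in a..b, ((u r t ^ m) ^ 2 + vr r t ^ 2) * Real.sinh r ^ n ≤
      ∫ r in Ioi (0:ℝ), ((u r t ^ m) ^ 2 + vr r t ^ 2) * Real.sinh r ^ n := by
    rw [intervalIntegral.integral_of_le hab]
    apply setIntegral_mono_set (h.en_int t ht)
    · filter_upwards [ae_restrict_mem measurableSet_Ioi] with x hx
      have := Real.sinh_pos_iff.2 hx
      simp only [Pi.zero_apply]; positivity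
    · exact hsub.eventuallyLE
  refine le_trans ?_ h1
  apply intervalIntegral.integral_mono_on hab
  · exact (continuousOn_const.mul hc).intervalIntegrable_of_Icc hab
  · exact (hc.mul (by fun_prop)).intervalIntegrable_of_Icc hab
  · intro x hx
    rw [mul_comm]
    have h0 : 0 ≤ Real.sinh a := (Real.sinh_pos_iff.2 ha).le
    gcongr
    exact Real.sinh_le_sinh.2 hx.1

lemma swap_le {n : ℕ} (hn : 1 ≤ n) {m A B C1 C2 : ℝ} (hm : 0 < m) {u1 vr1 ut1 u2 vr2 ut2 : ℝ → ℝ → ℝ}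
    (h1 : Sol n m A B C1 u1 vr1 ut1) (h2 : Sol n m A B C2 u2 vr2 ut2) {t1 t2 : ℝ}
    (ht1 : A < t1) (ht : t1 ≤ t2) (ht2 : t2 < B)
    (hle : ∀ r ≥ (0:ℝ), u1 r t1 ≤ u2 r t1) {R : ℝ} (hR : 0 ≤ R) :
    ∫ r in (0:ℝ)..R, max (u1 r t2 - u2 r t2) 0 * psi n r ≤
      ∫ t in t1..t2, (|vr1 R t - vr2 R t| + n * |u1 R t ^ m - u2 R t ^ m|) := by
  have hsub := Icc_rect_sub (a := 0) (b := R) le_rfl ht1 ht2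
  have hT : ∀ t ∈ Icc t1 t2, t ∈ Ioo A B := fun t h => ⟨ht1.trans_le h.1, h.2.trans_lt ht2⟩
  have hX : ∀ x ∈ Icc (0:ℝ) R, x ∈ Ici (0:ℝ) := fun x h => h.1
  have cf : ContinuousOn (fun p : ℝ × ℝ => u1 p.1 p.2 - u2 p.1 p.2) (Icc 0 R ×ˢ Icc t1 t2) :=
    (h1.cu.sub h2.cu).mono hsub
  have cft : ContinuousOn (fun p : ℝ × ℝ => (ut1 p.1 p.2 - ut2 p.1 p.2) * psi n p.1)
      (Icc 0 R ×ˢ Icc t1 t2) :=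
    ((h1.cut.sub h2.cut).mono hsub).mul ((psi_cont n).comp continuous_fst).continuousOn
  obtain ⟨hI, hsw⟩ := swap_ite (f := fun r t => u1 r t - u2 r t)
    (F := fun r t => (ut1 r t - ut2 r t) * psi n r) hR ht cf cft
  have e1 : ∫ r in (0:ℝ)..R, max (u1 r t2 - u2 r t2) 0 * psi n r =
      ∫ r in (0:ℝ)..R, ∫ t in t1..t2,
        (if 0 < u1 r t - u2 r t then (ut1 r t - ut2 r t) * psi n r else 0) := by
    apply intervalIntegral.integral_congr
    intro r hr
    rw [uIcc_of_le hR] at hr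
    have := pos_part_ftc (fun t => u1 r t - u2 r t) (fun t => ut1 r t - ut2 r t) ht
      (fun t h => (h1.dt r hr.1 t (hT t h)).sub (h2.dt r hr.1 t (hT t h)))
      (((slice_t h1.cut (hX r hr)).sub (slice_t h2.cut (hX r hr))).mono hT)
    have hz : max (u1 r t1 - u2 r t1) 0 = 0 := max_eq_right (by linarith [hle r hr.1])
    simp only [hz, sub_zero] at this
    simp only
    rw [this, ← intervalIntegral.integral_mul_const]
    simp only [ite_mul, zero_mul]
  rw [e1, hsw]
  have cb : ContinuousOn (fun t => (|vr1 R t - vr2 R t| + n * |u1 R t ^ m - u2 R t ^ m|)) (Icc t1 t2) := by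
    have a1 := ((slice_t h1.cvr hR).sub (slice_t h2.cvr hR)).mono hT
    have a2 := ((slice_t (g := fun r t => u1 r t ^ m) h1.cv hR).sub
      (slice_t (g := fun r t => u2 r t ^ m) h2.cv hR)).mono hT
    exact a1.abs.add (continuousOn_const.mul a2.abs)
  apply intervalIntegral.integral_mono_on ht
  · rw [intervalIntegrable_iff_integrableOn_Ioc_of_le ht]
    have hI' : Integrable (fun p : ℝ × ℝ => if 0 < u1 p.1 p.2 - u2 p.1 p.2 then
      (ut1 p.1 p.2 - ut2 p.1 p.2) * psi n p.1 else 0)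
      ((volume.restrict (Ioc 0 R)).prod (volume.restrict (Ioc t1 t2))) := by
      rw [Measure.prod_restrict]; exact hI
    have := hI'.integral_prod_right
    simp_rw [intervalIntegral.integral_of_le hR]
    exact this
  · exact cb.intervalIntegrable_of_Icc ht
  · intro t htt
    have htI := hT t htt
    have := kato n hn hR (fun r => u1 r t ^ m - u2 r t ^ m) (fun r => vr1 r t - vr2 r t)
      (fun r => ut1 r t - ut2 r t)
      (((slice_r (g := fun r t => u1 r t ^ m) h1.cv htI).sub
        (slice_r (g := fun r t => u2 r t ^ m) h2.cv htI)).mono hX)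
      (((slice_r h1.cvr htI).sub (slice_r h2.cvr htI)).mono hX)
      (((slice_r h1.cut htI).sub (slice_r h2.cut htI)).mono hX)
      (fun x hx => (h1.dr x hx.1 t htI).sub (h2.dr x hx.1 t htI))
      (fun x hx => ((h1.drr x hx.1 t htI).sub (h2.drr x hx.1 t htI)).congr_deriv (by ring))
    refine le_trans (le_of_eq ?_) this
    apply intervalIntegral.integral_congr
    intro r hr
    rw [uIcc_of_le hR] at hr
    have p1 := h1.pos r hr.1 t htI
    have p2 := h2.pos r hr.1 t htI
    have : (0 < u1 r t - u2 r t) ↔ (0 < u1 r t ^ m - u2 r t ^ m) := by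
      rw [sub_pos, sub_pos, Real.rpow_lt_rpow_iff p2.le p1.le hm]
    simp only [this]

lemma abs_young {a b c κ d : ℝ} (hκ : 0 < κ) (hc : a ^ 2 + b ^ 2 ≤ c) :
    |a| + d * |b| ≤ κ + (1 + d ^ 2) / (2 * κ) * c := by
  have h0 : (1 + d ^ 2) / (2 * κ) * (a ^ 2 + b ^ 2) ≤ (1 + d ^ 2) / (2 * κ) * c := by gcongr
  refine le_trans ?_ (add_le_add_right h0 κ)
  have : κ + (1 + d ^ 2) / (2 * κ) * (a ^ 2 + b ^ 2) - (|a| + d * |b|)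
      = ((κ - |a|)^2 + (κ - d * |b|)^2 + b^2 + d^2 * a^2) / (2 * κ) := by
    rw [← sq_abs a, ← sq_abs b]
    field_simp
    ring
  have h2 : 0 ≤ ((κ - |a|)^2 + (κ - d * |b|)^2 + b^2 + d^2 * a^2) / (2 * κ) := by positivity
  linarith

lemma comparison_pos {n : ℕ} (hn : 1 ≤ n) {m A B C1 C2 : ℝ} (hm : 0 < m)
    {u1 vr1 ut1 u2 vr2 ut2 : ℝ → ℝ → ℝ}
    (h1 : Sol n m A B C1 u1 vr1 ut1) (h2 : Sol n m A B C2 u2 vr2 ut2) {t1 t2 : ℝ}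
    (ht1 : A < t1) (ht : t1 < t2) (ht2 : t2 < B)
    (hle : ∀ r ≥ (0:ℝ), u1 r t1 ≤ u2 r t1) {r0 : ℝ} (hr0 : 0 < r0) : u1 r0 t2 ≤ u2 r0 t2 := by
  by_contra hcon
  push Not at hcon
  have ht2I : t2 ∈ Ioo A B := ⟨ht1.trans ht, ht2⟩
  have hT : ∀ t ∈ Icc t1 t2, t ∈ Ioo A B := fun t h => ⟨ht1.trans_le h.1, h.2.trans_lt ht2⟩
  set q : ℝ → ℝ := fun r => max (u1 r t2 - u2 r t2) 0 * psi n r with hq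
  have cq : ContinuousOn q (Ici 0) :=
    (((slice_r h1.cu ht2I).sub (slice_r h2.cu ht2I)).sup continuousOn_const).mul
      (psi_cont n).continuousOn
  have q0 : ∀ r, 0 ≤ r → 0 ≤ q r := fun r hr => mul_nonneg (le_max_right _ _) (psi_nonneg n hr)
  set R0 := r0 + 1 with hR0
  set g0 := ∫ r in (0:ℝ)..R0, q r with hg0
  have hR0p : 0 < R0 := by positivity
  have iq : ∀ a b, 0 ≤ a → a ≤ b → IntervalIntegrable q volume a b := fun a b ha hab =>
    (cq.mono (fun x hx => ha.trans hx.1)).intervalIntegrable_of_Icc hab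
  have g0pos : 0 < g0 := by
    apply intervalIntegral.integral_pos hR0p (cq.mono (fun x hx => hx.1))
    · exact fun x hx => q0 x hx.1.le
    · refine ⟨r0, ⟨hr0.le, by linarith⟩, ?_⟩
      have := psi_pos n hr0
      have h3 : 0 < max (u1 r0 t2 - u2 r0 t2) 0 := lt_max_of_lt_left (by linarith)
      positivity
  set e : ℝ → ℝ → ℝ := fun r t => ((u1 r t ^ m) ^ 2 + vr1 r t ^ 2) + ((u2 r t ^ m) ^ 2 + vr2 r t ^ 2) with he
  have ce : ContinuousOn (fun p : ℝ × ℝ => e p.1 p.2) (Ici 0 ×ˢ Ioo A B) :=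
    ((h1.cv.pow 2).add (h1.cvr.pow 2)).add ((h2.cv.pow 2).add (h2.cvr.pow 2))
  set τ := t2 - t1 with hτ
  have τp : 0 < τ := by linarith
  set κ := g0 / (2 * τ) with hκ
  have κp : 0 < κ := by positivity
  set K := (1 + (n:ℝ) ^ 2) / (2 * κ) * 2 with hK
  have Kp : 0 < K := by positivity
  have stepA : ∀ R, R0 ≤ R → g0 / 2 / K ≤ ∫ t in t1..t2, e R t := by
    intro R hR
    have hRp : 0 ≤ R := hR0p.le.trans hR
    have s1 := swap_le hn hm h1 h2 ht1 ht.le ht2 hle hRp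
    have s2 : g0 ≤ ∫ r in (0:ℝ)..R, q r := by
      rw [← intervalIntegral.integral_add_adjacent_intervals (iq 0 R0 le_rfl hR0p.le) (iq R0 R hR0p.le hR)]
      have : 0 ≤ ∫ r in R0..R, q r := intervalIntegral.integral_nonneg hR
        (fun x hx => q0 x (hR0p.le.trans hx.1))
      linarith
    have ceR : ContinuousOn (fun t => e R t) (Icc t1 t2) := (slice_t ce hRp).mono hT
    have s3 : ∫ t in t1..t2, (|vr1 R t - vr2 R t| + n * |u1 R t ^ m - u2 R t ^ m|) ≤
        ∫ t in t1..t2, (κ + K * e R t) := by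
      apply intervalIntegral.integral_mono_on ht.le
      · have a1 := ((slice_t h1.cvr hRp).sub (slice_t h2.cvr hRp)).mono hT
        have a2 := ((slice_t (g := fun r t => u1 r t ^ m) h1.cv hRp).sub
          (slice_t (g := fun r t => u2 r t ^ m) h2.cv hRp)).mono hT
        exact (a1.abs.add (continuousOn_const.mul a2.abs)).intervalIntegrable_of_Icc ht.le
      · exact (continuousOn_const.add (continuousOn_const.mul ceR)).intervalIntegrable_of_Icc ht.le
      · intro t _
        have := abs_young (a := vr1 R t - vr2 R t) (b := u1 R t ^ m - u2 R t ^ m) (c := 2 * e R t)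
          (d := (n:ℝ)) κp (by
            simp only [he]
            nlinarith [sq_nonneg (vr1 R t + vr2 R t), sq_nonneg (u1 R t ^ m + u2 R t ^ m)])
        refine this.trans (le_of_eq ?_)
        rw [hK]; ring
    have iK : IntervalIntegrable (fun t => K * e R t) volume t1 t2 :=
      (continuousOn_const.mul ceR).intervalIntegrable_of_Icc ht.le
    have iκ : IntervalIntegrable (fun _ : ℝ => κ) volume t1 t2 := by simp
    rw [intervalIntegral.integral_add iκ iK, intervalIntegral.integral_const, intervalIntegral.integral_const_mul, smul_eq_mul] at s3
    have s4 : (t2 - t1) * κ = g0 / 2 := by rw [hκ, ← hτ]; field_simp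
    rw [div_le_iff₀ Kp]
    simp only [hq] at s2
    linarith
  set S := Real.sinh R0 ^ n with hS
  have Sp : 0 < S := pow_pos (Real.sinh_pos_iff.2 hR0p) n
  have stepB : ∀ L, 0 < L → S * (L * (g0 / 2 / K)) ≤ τ * (C1 + C2) := by
    intro L hL
    have hRL : R0 ≤ R0 + L := by linarith
    have cr : ContinuousOn (fun p : ℝ × ℝ => e p.1 p.2) (Icc R0 (R0 + L) ×ˢ Icc t1 t2) :=
      ce.mono (Icc_rect_sub hR0p.le ht1 ht2)
    have sw := swap_cont (F := e) hRL ht.le cr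
    have b1 : ∫ r in R0..(R0+L), (g0 / 2 / K) ≤ ∫ r in R0..(R0+L), ∫ t in t1..t2, e r t := by
      apply intervalIntegral.integral_mono_on hRL (by simp)
      · rw [intervalIntegrable_iff_integrableOn_Ioc_of_le hRL]
        have hI := (cr.integrableOn_compact (μ := volume) (isCompact_Icc.prod isCompact_Icc)).mono_set
          (prod_mono (Ioc_subset_Icc_self (a := R0) (b := R0 + L)) (Ioc_subset_Icc_self (a := t1) (b := t2)))
        have hI' : Integrable (fun p : ℝ × ℝ => e p.1 p.2)
          ((volume.restrict (Ioc R0 (R0+L))).prod (volume.restrict (Ioc t1 t2))) := by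
          rw [Measure.prod_restrict]; exact hI
        have := hI'.integral_prod_left
        simp_rw [intervalIntegral.integral_of_le ht.le]
        exact this
      · exact fun x hx => stepA x hx.1
    rw [sw, intervalIntegral.integral_const, smul_eq_mul, add_sub_cancel_left] at b1
    have b2 : ∫ t in t1..t2, ∫ r in R0..(R0+L), e r t ≤ ∫ t in t1..t2, (C1 + C2) / S := by
      apply intervalIntegral.integral_mono_on ht.le
      · rw [intervalIntegrable_iff_integrableOn_Ioc_of_le ht.le]
        have hI := (cr.integrableOn_compact (μ := volume) (isCompact_Icc.prod isCompact_Icc)).mono_set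
          (prod_mono (Ioc_subset_Icc_self (a := R0) (b := R0 + L)) (Ioc_subset_Icc_self (a := t1) (b := t2)))
        have hI' : Integrable (fun p : ℝ × ℝ => e p.1 p.2)
          ((volume.restrict (Ioc R0 (R0+L))).prod (volume.restrict (Ioc t1 t2))) := by
          rw [Measure.prod_restrict]; exact hI
        have := hI'.integral_prod_right
        simp_rw [intervalIntegral.integral_of_le hRL]
        exact this
      · simp
      · intro t htt
        have htI := hT t htt
        have hsub : Icc R0 (R0 + L) ⊆ Ici (0:ℝ) := fun x hx => hR0p.le.trans hx.1
        have i1 := ((((slice_r (g := fun r t => u1 r t ^ m) h1.cv htI).pow 2).add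
          ((slice_r h1.cvr htI).pow 2)).mono hsub).intervalIntegrable_of_Icc (μ := volume) hRL
        have i2 := ((((slice_r (g := fun r t => u2 r t ^ m) h2.cv htI).pow 2).add
          ((slice_r h2.cvr htI).pow 2)).mono hsub).intervalIntegrable_of_Icc (μ := volume) hRL
        have e1 := energy_Icc h1 hR0p hRL htI
        have e2 := energy_Icc h2 hR0p hRL htI
        rw [le_div_iff₀ Sp]
        have : ∫ r in R0..(R0+L), e r t = (∫ r in R0..(R0+L), ((u1 r t ^ m) ^ 2 + vr1 r t ^ 2))
          + ∫ r in R0..(R0+L), ((u2 r t ^ m) ^ 2 + vr2 r t ^ 2) := intervalIntegral.integral_add i1 i2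
        rw [this]
        linarith
    rw [intervalIntegral.integral_const, smul_eq_mul] at b2
    have b3 := b1.trans b2
    rw [← mul_div_assoc (t2 - t1), le_div_iff₀ Sp] at b3
    linarith
  have cpos : 0 < S * (g0 / 2 / K) := by positivity
  have b := stepB ((|τ * (C1 + C2)| + 1) / (S * (g0 / 2 / K))) (by positivity)
  have : S * ((|τ * (C1 + C2)| + 1) / (S * (g0 / 2 / K)) * (g0 / 2 / K)) = |τ * (C1 + C2)| + 1 := by
    field_simp
  rw [this] at b
  linarith [le_abs_self (τ * (C1 + C2))]

/-- extend an inequality between continuous functions to the endpoint -/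
lemma ext_zero {f g : ℝ → ℝ} (hf : ContinuousOn f (Ici 0)) (hg : ContinuousOn g (Ici 0))
    (h : ∀ r > (0:ℝ), f r ≤ g r) : ∀ r ≥ (0:ℝ), f r ≤ g r := by
  intro r hr
  rcases hr.eq_or_lt with h0 | h0
  · subst h0
    have a1 : Tendsto f (𝓝[>] 0) (𝓝 (f 0)) :=
      (hf 0 self_mem_Ici).mono_left (nhdsWithin_mono _ Ioi_subset_Ici_self)
    have a2 : Tendsto g (𝓝[>] 0) (𝓝 (g 0)) :=
      (hg 0 self_mem_Ici).mono_left (nhdsWithin_mono _ Ioi_subset_Ici_self)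
    refine le_of_tendsto_of_tendsto a1 a2 ?_
    filter_upwards [self_mem_nhdsWithin] with x hx using h x hx
  · exact h r h0

lemma Sol.mono {n : ℕ} {m A B A' B' C : ℝ} {u vr ut : ℝ → ℝ → ℝ} (h : Sol n m A B C u vr ut)
    (hA : A ≤ A') (hB : B' ≤ B) : Sol n m A' B' C u vr ut := by
  have hI : Ioo A' B' ⊆ Ioo A B := Ioo_subset_Ioo hA hB
  have hP : Ici (0:ℝ) ×ˢ Ioo A' B' ⊆ Ici (0:ℝ) ×ˢ Ioo A B := prod_mono_right hI
  exact ⟨h.cu.mono hP, h.cut.mono hP, h.cvr.mono hP, fun r hr t ht => h.pos r hr t (hI ht),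
    fun r hr t ht => h.dt r hr t (hI ht), fun r hr t ht => h.dr r hr t (hI ht),
    fun r hr t ht => h.drr r hr t (hI ht), fun t ht => h.en_int t (hI ht), fun t ht => h.en_le t (hI ht)⟩

lemma Sol.scale {n : ℕ} {m A B C : ℝ} {u vr ut : ℝ → ℝ → ℝ} (h : Sol n m A B C u vr ut)
    {A' B' lam c ε : ℝ} (hc : 0 < c) (hcl : c * lam = c ^ m)
    (hmap : ∀ t ∈ Ioo A' B', ε + lam * (t - ε) ∈ Ioo A B) :
    Sol n m A' B' ((c ^ m) ^ 2 * C) (fun r t => c * u r (ε + lam * (t - ε)))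
      (fun r t => c ^ m * vr r (ε + lam * (t - ε)))
      (fun r t => c * lam * ut r (ε + lam * (t - ε))) := by
  have hmp : MapsTo (fun p : ℝ × ℝ => (p.1, ε + lam * (p.2 - ε))) (Ici (0:ℝ) ×ˢ Ioo A' B')
      (Ici (0:ℝ) ×ˢ Ioo A B) := fun p hp => ⟨hp.1, hmap _ hp.2⟩
  have hcf : ContinuousOn (fun p : ℝ × ℝ => (p.1, ε + lam * (p.2 - ε))) (Ici (0:ℝ) ×ˢ Ioo A' B') := by
    fun_prop
  have cm : 0 < c ^ m := Real.rpow_pos_of_pos hc m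
  have hv : ∀ r ∈ Ici (0:ℝ), ∀ t ∈ Ioo A' B', (c * u r (ε + lam * (t - ε))) ^ m =
      c ^ m * u r (ε + lam * (t - ε)) ^ m := fun r hr t ht =>
    Real.mul_rpow hc.le (h.pos r hr _ (hmap t ht)).le
  have hen : ∀ t ∈ Ioo A' B', EqOn (fun r => (((c * u r (ε + lam * (t - ε))) ^ m) ^ 2
        + (c ^ m * vr r (ε + lam * (t - ε))) ^ 2) * Real.sinh r ^ n)
        (fun r => (c ^ m) ^ 2 * (((u r (ε + lam * (t - ε)) ^ m) ^ 2
        + (vr r (ε + lam * (t - ε))) ^ 2) * Real.sinh r ^ n)) (Ioi 0) := by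
    intro t ht r hr
    simp only
    rw [hv r (Ioi_subset_Ici_self hr) t ht]; ring
  refine ⟨?_, ?_, ?_, ?_, ?_, ?_, ?_, ?_, ?_⟩
  · exact continuousOn_const.mul (h.cu.comp hcf hmp)
  · exact continuousOn_const.mul (h.cut.comp hcf hmp)
  · exact continuousOn_const.mul (h.cvr.comp hcf hmp)
  · exact fun r hr t ht => mul_pos hc (h.pos r hr _ (hmap t ht))
  · intro r hr t ht
    have h1 := h.dt r hr _ (hmap t ht)
    have h2 : HasDerivAt (fun τ => ε + lam * (τ - ε)) lam t := by
      simpa using (((hasDerivAt_id t).sub_const ε).const_mul lam).const_add ε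
    exact ((h1.comp t h2).const_mul c).congr_deriv (by ring)
  · intro r hr t ht
    have h1 := (h.dr r hr _ (hmap t ht)).const_mul (c ^ m)
    refine h1.congr_of_eventuallyEq ?_
    filter_upwards [lt_mem_nhds hr] with x hx
    exact hv x (mem_Ici.2 (le_of_lt hx)) t ht
  · intro r hr t ht
    have h1 := (h.drr r hr _ (hmap t ht)).const_mul (c ^ m)
    refine h1.congr_deriv ?_
    rw [hcl]; ring
  · intro t ht
    exact (integrableOn_congr_fun (hen t ht) measurableSet_Ioi).2 ((h.en_int _ (hmap t ht)).const_mul _)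
  · intro t ht
    rw [setIntegral_congr_fun measurableSet_Ioi (hen t ht), integral_const_mul]
    exact mul_le_mul_of_nonneg_left (h.en_le _ (hmap t ht)) (by positivity)

/-- Benilan-Crandall -/
lemma benilan_crandall {n : ℕ} (hn : 1 ≤ n) {m A B C : ℝ} (hm : 0 < m) (hm1 : m < 1)
    {u vr ut : ℝ → ℝ → ℝ} (h : Sol n m A B C u vr ut) {ε t s : ℝ} (hε : A < ε) (ht : ε < t)
    (hts : t ≤ s) (hs : s < B) :
    ∀ r ≥ (0:ℝ), u r s ≤ ((s - ε) / (t - ε)) ^ (1 / (1 - m)) * u r t := by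
  set lam := (s - ε) / (t - ε) with hlam
  have hte : 0 < t - ε := by linarith
  have hl1 : 1 ≤ lam := by rw [hlam, one_le_div hte]; linarith
  have hl0 : 0 < lam := by linarith
  have hm' : 0 < 1 - m := by linarith
  set a := 1 / (1 - m) with ha
  set c := lam ^ (-a) with hc
  have c0 : 0 < c := Real.rpow_pos_of_pos hl0 _
  have c1 : c ≤ 1 := Real.rpow_le_one_of_one_le_of_nonpos hl1 (by rw [neg_nonpos]; positivity)
  have hcl : c * lam = c ^ m := by
    rw [hc, ← Real.rpow_mul hl0.le]
    nth_rewrite 2 [← Real.rpow_one lam]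
    rw [← Real.rpow_add hl0]
    congr 1
    rw [ha]; field_simp; ring
  set B' := ε + (B - ε) / lam with hB'
  have hBe : 0 < B - ε := by linarith
  have hB'B : B' ≤ B := by
    have : (B - ε) / lam ≤ B - ε := div_le_self hBe.le hl1
    linarith
  set A' := ε - (ε - A) / lam with hA'
  have hAA' : A ≤ A' := by
    have : (ε - A) / lam ≤ ε - A := div_le_self (by linarith) hl1
    linarith
  have hA'e : A' < ε := by
    have : 0 < (ε - A) / lam := div_pos (by linarith) hl0
    linarith
  have hmap : ∀ x ∈ Ioo A' B', ε + lam * (x - ε) ∈ Ioo A B := by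
    intro x hx
    have e1 : lam * ((ε - A) / lam) = ε - A := by field_simp
    have e2 : lam * ((B - ε) / lam) = B - ε := by field_simp
    have i1 := mul_lt_mul_of_pos_left hx.1 hl0
    have i2 := mul_lt_mul_of_pos_left hx.2 hl0
    constructor
    · rw [hA'] at i1; linarith
    · rw [hB'] at i2; linarith
  have hS1 := h.scale c0 hcl hmap
  have hS2 := h.mono hAA' hB'B
  have hst : ε + lam * (t - ε) = s := by rw [hlam]; field_simp; ring
  have htB' : t < B' := by
    rw [hB', ← sub_lt_iff_lt_add', lt_div_iff₀ hl0]
    linarith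
  have key : ∀ r > (0:ℝ), c * u r s ≤ u r t := by
    intro r hr
    have := comparison_pos hn hm hS1 hS2 hA'e ht htB' (by
      intro r hr
      simp only [sub_self, mul_zero, add_zero]
      exact mul_le_of_le_one_left (h.pos r hr ε ⟨hε, by linarith⟩).le c1) hr
    rwa [hst] at this
  have key2 := ext_zero (f := fun r => c * u r s) (continuousOn_const.mul
    (slice_r h.cu (t := s) ⟨by linarith, hs⟩))
    (slice_r h.cu (t := t) ⟨by linarith, by linarith⟩) key
  intro r hr
  have k := key2 r hr
  have : lam ^ a * c = 1 := by rw [hc, ← Real.rpow_add hl0]; simp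
  calc u r s = lam ^ a * (c * u r s) := by rw [← mul_assoc, this, one_mul]
    _ ≤ lam ^ a * u r t := by gcongr

lemma exists_sol (N : ℕ) (hN : 3 ≤ N) (m T : ℝ) (u : ℝ → ℝ → ℝ)
    (hu : IsRadialEnergySolution N m T u) {A : ℝ} (hA : A ∈ Ioo 0 T) :
    ∃ (C : ℝ) (vr ut : ℝ → ℝ → ℝ), Sol (N - 1) m A T C u vr ut := by
  obtain ⟨C, hC⟩ := hu.energy_bdd A hA
  set F : ℝ × ℝ → ℝ := fun p => u p.1 p.2 with hF
  set K : Set (ℝ × ℝ) := Ici 0 ×ˢ Ioo 0 T with hK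
  have hKu : UniqueDiffOn ℝ K := (uniqueDiffOn_Ici 0).prod (uniqueDiffOn_Ioo 0 T)
  have hsm : ContDiffOn ℝ (⊤ : ℕ∞) F K := hu.smooth
  have hcfd : ContinuousOn (fderivWithin ℝ F K) K :=
    hsm.continuousOn_fderivWithin hKu (by simp)
  have hfd : ∀ p ∈ K, HasFDerivWithinAt F (fderivWithin ℝ F K p) K p := fun p hp =>
    ((hsm.differentiableOn (by simp)) p hp).hasFDerivWithinAt
  set ut : ℝ → ℝ → ℝ := fun r t => fderivWithin ℝ F K (r, t) (0, 1) with hut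
  set ur : ℝ → ℝ → ℝ := fun r t => fderivWithin ℝ F K (r, t) (1, 0) with hur
  set vr : ℝ → ℝ → ℝ := fun r t => ur r t * m * u r t ^ (m - 1) with hvr
  have hI : Ioo A T ⊆ Ioo 0 T := Ioo_subset_Ioo hA.1.le le_rfl
  have hP : Ici (0:ℝ) ×ˢ Ioo A T ⊆ K := prod_mono_right hI
  have cut : ContinuousOn (fun p : ℝ × ℝ => ut p.1 p.2) K := hcfd.clm_apply continuousOn_const
  have cur : ContinuousOn (fun p : ℝ × ℝ => ur p.1 p.2) K := hcfd.clm_apply continuousOn_const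
  have cu : ContinuousOn (fun p : ℝ × ℝ => u p.1 p.2) K := hsm.continuousOn
  have cvr : ContinuousOn (fun p : ℝ × ℝ => vr p.1 p.2) K :=
    (cur.mul continuousOn_const).mul
      (cu.rpow_const (fun p hp => Or.inl (hu.pos p.1 hp.1 p.2 hp.2).ne'))
  have dt : ∀ r ∈ Ici (0:ℝ), ∀ t ∈ Ioo 0 T, HasDerivAt (fun τ => u r τ) (ut r t) t := by
    intro r hr t ht
    have h1 : HasDerivWithinAt (fun τ : ℝ => (r, τ)) ((0:ℝ), (1:ℝ)) (Ioo 0 T) t :=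
      ((hasDerivAt_const t r).prodMk (hasDerivAt_id t)).hasDerivWithinAt
    have h2 := (hfd (r, t) ⟨hr, ht⟩).comp_hasDerivWithinAt (f := fun τ : ℝ => (r, τ)) t h1
      (fun τ hτ => ⟨hr, hτ⟩)
    exact h2.hasDerivAt (Ioo_mem_nhds ht.1 ht.2)
  have dur : ∀ r > (0:ℝ), ∀ t ∈ Ioo 0 T, HasDerivAt (fun ρ => u ρ t) (ur r t) r := by
    intro r hr t ht
    have h1 : HasDerivWithinAt (fun τ : ℝ => (τ, t)) ((1:ℝ), (0:ℝ)) (Ioi 0) r :=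
      ((hasDerivAt_id r).prodMk (hasDerivAt_const r t)).hasDerivWithinAt
    have h2 := (hfd (r, t) ⟨hr.le, ht⟩).comp_hasDerivWithinAt (f := fun τ : ℝ => (τ, t)) r h1
      (fun τ hτ => ⟨Ioi_subset_Ici_self hτ, ht⟩)
    exact h2.hasDerivAt (Ioi_mem_nhds hr)
  have dr : ∀ r > (0:ℝ), ∀ t ∈ Ioo 0 T, HasDerivAt (fun ρ => u ρ t ^ m) (vr r t) r := by
    intro r hr t ht
    exact (dur r hr t ht).rpow_const (Or.inl (hu.pos r (mem_Ici.2 (le_of_lt hr)) t ht).ne')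
  have hcast : ((N - 1 : ℕ) : ℝ) = (N : ℝ) - 1 := by
    rw [Nat.cast_sub (by omega)]; simp
  have drr : ∀ r > (0:ℝ), ∀ t ∈ Ioo 0 T, HasDerivAt (fun ρ => vr ρ t)
    (ut r t - ((N - 1 : ℕ) : ℝ) * (Real.cosh r / Real.sinh r) * vr r t) r := by
    intro r hr t ht
    have hnb : K ∈ 𝓝 (r, t) := prod_mem_nhds (Ici_mem_nhds hr) (Ioo_mem_nhds ht.1 ht.2)
    have c1 : ContDiffAt ℝ (⊤ : ℕ∞) F (r, t) := hsm.contDiffAt hnb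
    have c2 : ContDiffAt ℝ (⊤ : ℕ∞) (fun ρ => u ρ t) r :=
      c1.comp (f := fun ρ : ℝ => (ρ, t)) r (contDiffAt_id.prodMk contDiffAt_const)
    have c3 : ContDiffAt ℝ (⊤ : ℕ∞) (fun ρ => u ρ t ^ m) r :=
      c2.rpow_const_of_ne (hu.pos r (mem_Ici.2 (le_of_lt hr)) t ht).ne'
    have hev : (fun ρ => vr ρ t) =ᶠ[𝓝 r] deriv (fun ρ => u ρ t ^ m) := by
      filter_upwards [lt_mem_nhds hr] with x hx
      exact ((dr x hx t ht).deriv).symm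
    have c4 : DifferentiableAt ℝ (deriv (fun ρ => u ρ t ^ m)) r := by
      have : ContDiffAt ℝ 1 (deriv (fun ρ => u ρ t ^ m)) r :=
        c3.derivWithin (by norm_num; exact WithTop.coe_le_coe.2 le_top)
      exact this.differentiableAt (by simp)
    refine (c4.hasDerivAt.congr_of_eventuallyEq hev).congr_deriv ?_
    have hp := hu.pde r hr t ht
    rw [(dt r (mem_Ici.2 (le_of_lt hr)) t ht).deriv, (dr r hr t ht).deriv] at hp
    rw [hcast]
    linarith
  have hen : ∀ t ∈ Ioo 0 T, EqOn (fun r => ((u r t ^ m) ^ 2 + vr r t ^ 2) * Real.sinh r ^ (N - 1))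
      (fun r => (u r t ^ m) ^ 2 * Real.sinh r ^ (N - 1) +
        (deriv (fun ρ => u ρ t ^ m) r) ^ 2 * Real.sinh r ^ (N - 1)) (Ioi 0) := by
    intro t ht r hr
    simp only
    rw [(dr r hr t ht).deriv]; ring
  refine ⟨C, vr, ut, cu.mono hP, cut.mono hP, cvr.mono hP, fun r hr t ht => hu.pos r hr t (hI ht),
    fun r hr t ht => dt r hr t (hI ht), fun r hr t ht => dr r hr t (hI ht),
    fun r hr t ht => drr r hr t (hI ht), ?_, ?_⟩
  · intro t ht
    obtain ⟨_, e1, e2⟩ := hu.energy t (hI ht)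
    exact (integrableOn_congr_fun (hen t (hI ht)) measurableSet_Ioi).2 (e1.add e2)
  · intro t ht
    obtain ⟨_, e1, e2⟩ := hu.energy t (hI ht)
    rw [setIntegral_congr_fun measurableSet_Ioi (hen t (hI ht)), integral_add e1 e2]
    exact hC t ⟨ht.1.le, ht.2⟩

lemma flux {n : ℕ} (hn : 1 ≤ n) {m A B C : ℝ} {u vr ut : ℝ → ℝ → ℝ} (h : Sol n m A B C u vr ut)
    {r t : ℝ} (hr : 0 < r) (ht : t ∈ Ioo A B) :
    ∫ ρ in (0:ℝ)..r, Real.sinh ρ ^ n * ut ρ t = Real.sinh r ^ n * vr r t := by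
  have hX : ∀ x ∈ Icc (0:ℝ) r, x ∈ Ici (0:ℝ) := fun x h => h.1
  have cs : ContinuousOn (fun x : ℝ => Real.sinh x ^ n) (Icc 0 r) := by fun_prop
  have := intervalIntegral.integral_eq_sub_of_hasDerivAt_of_le hr.le
    (f := fun ρ => Real.sinh ρ ^ n * vr ρ t) (f' := fun ρ => Real.sinh ρ ^ n * ut ρ t)
    (cs.mul ((slice_r h.cvr ht).mono hX))
    (by
      intro x hx
      refine (((Real.hasDerivAt_sinh x).pow n).mul (h.drr x hx.1 t ht)).congr_deriv ?_
      have hs : Real.sinh x ≠ 0 := (Real.sinh_pos_iff.2 hx.1).ne'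
      obtain ⟨k, rfl⟩ : ∃ k, n = k + 1 := ⟨n - 1, by omega⟩
      simp only [Nat.add_sub_cancel, Pi.pow_apply]
      field_simp
      ring)
    ((cs.mul ((slice_r h.cut ht).mono hX)).intervalIntegrable_of_Icc hr.le)
  rw [this]
  have hn0 : n ≠ 0 := by omega
  simp [hn0]

lemma V_identity {n : ℕ} (hn : 1 ≤ n) {m A B C : ℝ} {u vr ut : ℝ → ℝ → ℝ}
    (h : Sol n m A B C u vr ut) {r1 r2 t1 t2 : ℝ} (hr1 : 0 < r1) (hr : r1 ≤ r2)
    (ht1 : A < t1) (ht : t1 ≤ t2) (ht2 : t2 < B) :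
    (∫ s in t1..t2, u r1 s ^ m) - ∫ s in t1..t2, u r2 s ^ m =
      ∫ r in r1..r2, (Real.sinh r ^ n)⁻¹ *
        ∫ ρ in (0:ℝ)..r, Real.sinh ρ ^ n * (u ρ t1 - u ρ t2) := by
  have hT : ∀ t ∈ Icc t1 t2, t ∈ Ioo A B := fun t h => ⟨ht1.trans_le h.1, h.2.trans_lt ht2⟩
  have hr2 : 0 < r2 := hr1.trans_le hr
  have iv : ∀ r, 0 ≤ r → IntervalIntegrable (fun s => u r s ^ m) volume t1 t2 := fun r hr =>
    ((slice_t (g := fun r t => u r t ^ m) h.cv (mem_Ici.2 hr)).mono hT).intervalIntegrable_of_Icc ht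
  rw [← intervalIntegral.integral_sub (iv r1 hr1.le) (iv r2 hr2.le)]
  have e1 : ∫ s in t1..t2, (u r1 s ^ m - u r2 s ^ m) = ∫ s in t1..t2, ∫ r in r1..r2, -vr r s := by
    apply intervalIntegral.integral_congr
    intro s hs
    rw [uIcc_of_le ht] at hs
    have := intervalIntegral.integral_eq_sub_of_hasDerivAt (a := r1) (b := r2)
      (f := fun r => u r s ^ m) (f' := fun r => vr r s)
      (by
        intro x hx
        rw [uIcc_of_le hr] at hx
        exact h.dr x (hr1.trans_le hx.1) s (hT s hs))
      (((slice_r h.cvr (hT s hs)).mono (fun x hx => hr1.le.trans hx.1)).intervalIntegrable_of_Icc hr)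
    simp only [intervalIntegral.integral_neg]
    rw [this]; ring
  rw [e1, ← swap_cont (F := fun r s => -vr r s) hr ht
    ((h.cvr.mono (Icc_rect_sub hr1.le ht1 ht2)).neg)]
  apply intervalIntegral.integral_congr
  intro r hrr
  rw [uIcc_of_le hr] at hrr
  have hrp : 0 < r := hr1.trans_le hrr.1
  have hS : Real.sinh r ^ n ≠ 0 := (pow_pos (Real.sinh_pos_iff.2 hrp) n).ne'
  simp only
  rw [eq_inv_mul_iff_mul_eq₀ hS, ← intervalIntegral.integral_const_mul]
  have e2 : ∫ s in t1..t2, Real.sinh r ^ n * -vr r s =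
      ∫ s in t1..t2, ∫ ρ in (0:ℝ)..r, Real.sinh ρ ^ n * -ut ρ s := by
    apply intervalIntegral.integral_congr
    intro s hs
    rw [uIcc_of_le ht] at hs
    have := flux hn h hrp (hT s hs)
    simp only [mul_neg, intervalIntegral.integral_neg]
    rw [this]
  rw [e2, ← swap_cont (F := fun ρ s => Real.sinh ρ ^ n * -ut ρ s) hrp.le ht (by
    refine ContinuousOn.mul ?_ ((h.cut.mono (Icc_rect_sub le_rfl ht1 ht2)).neg)
    fun_prop)]
  apply intervalIntegral.integral_congr
  intro ρ hρ
  rw [uIcc_of_le hrp.le] at hρ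
  simp only
  rw [intervalIntegral.integral_const_mul, intervalIntegral.integral_neg]
  have := intervalIntegral.integral_eq_sub_of_hasDerivAt (a := t1) (b := t2)
      (f := fun t => u ρ t) (f' := fun t => ut ρ t)
      (by
        intro x hx
        rw [uIcc_of_le ht] at hx
        exact h.dt ρ hρ.1 x (hT x hx))
      (((slice_t h.cut (mem_Ici.2 hρ.1)).mono hT).intervalIntegrable_of_Icc ht)
  rw [this]; ring

lemma decay_sq {n : ℕ} {m A B C : ℝ} {u vr ut : ℝ → ℝ → ℝ}
    (h : Sol n m A B C u vr ut) {r t : ℝ} (hr : 0 < r) (ht : t ∈ Ioo A B) :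
    Real.sinh r ^ n * (u r t ^ m) ^ 2 ≤ 2 * C := by
  set S := Real.sinh r ^ n with hS
  have Sp : 0 < S := pow_pos (Real.sinh_pos_iff.2 hr) n
  have cE : ContinuousOn (fun r => (u r t ^ m) ^ 2 + vr r t ^ 2) (Ici 0) :=
    ((slice_r (g := fun r t => u r t ^ m) h.cv ht).pow 2).add ((slice_r h.cvr ht).pow 2)
  have cP : ContinuousOn (fun r => 2 * (u r t ^ m) * vr r t) (Ici 0) :=
    ((continuousOn_const.mul (slice_r (g := fun r t => u r t ^ m) h.cv ht))).mul (slice_r h.cvr ht)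
  have hsub : ∀ x, Icc r x ⊆ Ici (0:ℝ) := fun x y hy => hr.le.trans hy.1
  have step : ∀ x ∈ Icc r (r+1), (u r t ^ m) ^ 2 - C / S ≤ (u x t ^ m) ^ 2 := by
    intro x hx
    have ftc := intervalIntegral.integral_eq_sub_of_hasDerivAt (a := r) (b := x)
      (f := fun r => (u r t ^ m) ^ 2) (f' := fun r => 2 * (u r t ^ m) * vr r t)
      (by
        intro y hy
        rw [uIcc_of_le hx.1] at hy
        refine ((h.dr y (hr.trans_le hy.1) t ht).pow 2).congr_deriv ?_
        simp)
      ((cP.mono (hsub x)).intervalIntegrable_of_Icc hx.1)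
    have e := energy_Icc h hr hx.1 ht
    rw [mul_comm, ← le_div_iff₀ Sp] at e
    have lb : ∫ y in r..x, -((u y t ^ m) ^ 2 + vr y t ^ 2) ≤ ∫ y in r..x, 2 * (u y t ^ m) * vr y t := by
      apply intervalIntegral.integral_mono_on hx.1
      · exact (cE.mono (hsub x)).neg.intervalIntegrable_of_Icc hx.1
      · exact (cP.mono (hsub x)).intervalIntegrable_of_Icc hx.1
      · intro y _
        nlinarith [sq_nonneg (u y t ^ m + vr y t)]
    rw [intervalIntegral.integral_neg] at lb
    linarith
  have hr1 : r ≤ r + 1 := by linarith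
  have e := energy_Icc h hr hr1 ht
  rw [mul_comm, ← le_div_iff₀ Sp] at e
  have lb : ∫ y in r..(r+1), ((u r t ^ m) ^ 2 - C / S) ≤ ∫ y in r..(r+1), ((u y t ^ m) ^ 2 + vr y t ^ 2) := by
    apply intervalIntegral.integral_mono_on hr1 (by simp)
    · exact (cE.mono (hsub _)).intervalIntegrable_of_Icc hr1
    · intro y hy
      have := step y hy
      have := sq_nonneg (vr y t)
      linarith
  rw [intervalIntegral.integral_const, smul_eq_mul, add_sub_cancel_left, one_mul] at lb
  have : (u r t ^ m) ^ 2 ≤ 2 * C / S := by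
    have : 2 * C / S = C / S + C / S := by ring
    linarith
  rw [le_div_iff₀ Sp] at this
  linarith

lemma exp_le_sinh {r : ℝ} (hr : 1 ≤ r) : Real.exp r / 4 ≤ Real.sinh r := by
  rw [Real.sinh_eq]
  have h1 : Real.exp (-r) ≤ 1 := Real.exp_le_one_iff.2 (by linarith)
  have h2 : r + 1 ≤ Real.exp r := Real.add_one_le_exp r
  linarith

lemma sinh_pow_le (n : ℕ) {r : ℝ} (hr : 0 ≤ r) : Real.sinh r ^ n ≤ Real.exp ((n:ℝ) * r) := by
  rw [Real.exp_nat_mul]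
  exact pow_le_pow_left₀ (Real.sinh_nonneg_iff.2 hr) (sinh_le_exp r) n

lemma le_sinh_pow (n : ℕ) {r : ℝ} (hr : 1 ≤ r) : Real.exp ((n:ℝ) * r) / 4 ^ n ≤ Real.sinh r ^ n := by
  rw [Real.exp_nat_mul, ← div_pow]
  exact pow_le_pow_left₀ (by positivity) (exp_le_sinh hr) n

lemma inv_sinh_pow_le (n : ℕ) {r : ℝ} (hr : 1 ≤ r) :
    (Real.sinh r ^ n)⁻¹ ≤ 4 ^ n * Real.exp (-(n:ℝ) * r) := by
  have h := le_sinh_pow n hr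
  have : 4 ^ n * Real.exp (-(n:ℝ) * r) = (Real.exp ((n:ℝ) * r) / 4 ^ n)⁻¹ := by
    rw [neg_mul, Real.exp_neg]; field_simp
  rw [this]
  exact inv_anti₀ (by positivity) h

lemma decay_half {n : ℕ} {m A B C : ℝ} {u vr ut : ℝ → ℝ → ℝ}
    (h : Sol n m A B C u vr ut) {r t : ℝ} (hr : 1 ≤ r) (ht : t ∈ Ioo A B) :
    u r t ^ m ≤ Real.sqrt (2 * C * 4 ^ n) * Real.exp (-((n:ℝ) / 2) * r) := by
  have h1 := decay_sq h (by linarith : 0 < r) ht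
  have h2 := le_sinh_pow n hr
  have h3 : Real.exp ((n:ℝ) * r) / 4 ^ n * (u r t ^ m) ^ 2 ≤ 2 * C :=
    (mul_le_mul_of_nonneg_right h2 (sq_nonneg _)).trans h1
  have hv : 0 < u r t ^ m := Real.rpow_pos_of_pos (h.pos r (mem_Ici.2 (by linarith)) t ht) m
  have h4 : (u r t ^ m * Real.exp ((n:ℝ) / 2 * r)) ^ 2 ≤ 2 * C * 4 ^ n := by
    have : Real.exp ((n:ℝ) * r) = Real.exp ((n:ℝ) / 2 * r) ^ 2 := by
      rw [← Real.exp_nat_mul]; congr 1; push_cast; ring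
    rw [this, div_mul_eq_mul_div, div_le_iff₀ (by positivity)] at h3
    rw [mul_pow]; linarith
  have h5 := Real.le_sqrt_of_sq_le h4
  have h6 : Real.exp (-((n:ℝ) / 2) * r) = (Real.exp ((n:ℝ) / 2 * r))⁻¹ := by
    rw [neg_mul, Real.exp_neg]
  rw [h6, ← div_eq_mul_inv, le_div_iff₀ (Real.exp_pos _)]
  exact h5

lemma extend_upper {f : ℝ → ℝ} (hf : ContinuousOn f (Ici 0)) {α D : ℝ} (hα : 0 ≤ α)
    (h : ∀ r ≥ (1:ℝ), f r ≤ D * Real.exp (-α * r)) :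
    ∃ D' > 0, ∀ r ≥ (0:ℝ), f r ≤ D' * Real.exp (-α * r) := by
  obtain ⟨M, hM⟩ := (isCompact_Icc (a := (0:ℝ)) (b := 1)).exists_bound_of_continuousOn
    (hf.mono (fun x hx => hx.1))
  refine ⟨|D| + |M| * Real.exp α + 1, by positivity, ?_⟩
  intro r hr
  have e0 := Real.exp_pos (-α * r)
  rcases le_total 1 r with h1 | h1
  · refine (h r h1).trans ?_
    gcongr
    have : 0 ≤ |M| * Real.exp α := by positivity
    linarith [le_abs_self D]
  · have a1 := hM r ⟨hr, h1⟩
    have a2 : f r ≤ |M| := (le_abs_self _).trans (a1.trans (le_abs_self M))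
    have a3 : 1 ≤ Real.exp α * Real.exp (-α * r) := by
      rw [← Real.exp_add]; apply Real.one_le_exp; nlinarith
    have a4 : |M| * 1 ≤ |M| * (Real.exp α * Real.exp (-α * r)) := by gcongr
    have a5 : 0 ≤ (|D| + 1) * Real.exp (-α * r) := by positivity
    nlinarith

lemma extend_lower {f : ℝ → ℝ} (hf : ContinuousOn f (Ici 0)) (hpos : ∀ r ≥ (0:ℝ), 0 < f r)
    {α D : ℝ} (hα : 0 ≤ α) (hD : 0 < D)
    (h : ∀ r ≥ (1:ℝ), D * Real.exp (-α * r) ≤ f r) :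
    ∃ D' > 0, ∀ r ≥ (0:ℝ), D' * Real.exp (-α * r) ≤ f r := by
  obtain ⟨x, hx, hmin⟩ := (isCompact_Icc (a := (0:ℝ)) (b := 1)).exists_isMinOn
    (nonempty_Icc.2 zero_le_one) (hf.mono (fun x hx => hx.1))
  refine ⟨min D (f x), lt_min hD (hpos x hx.1), ?_⟩
  intro r hr
  rcases le_total 1 r with h1 | h1
  · refine le_trans ?_ (h r h1)
    gcongr
    exact min_le_left _ _
  · have a1 : f x ≤ f r := hmin ⟨hr, h1⟩
    have a2 : Real.exp (-α * r) ≤ 1 := Real.exp_le_one_iff.2 (by nlinarith)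
    calc _ ≤ f x * 1 := mul_le_mul (min_le_right _ _) a2 (Real.exp_pos _).le (hpos x hx.1).le
      _ ≤ f r := by linarith

lemma int_exp {c : ℝ} (hc : c ≠ 0) (a b : ℝ) :
    ∫ x in a..b, Real.exp (c * x) = (Real.exp (c * b) - Real.exp (c * a)) / c := by
  have := intervalIntegral.integral_eq_sub_of_hasDerivAt (a := a) (b := b)
    (f := fun x => Real.exp (c * x) / c) (f' := fun x => Real.exp (c * x))
    (by
      intro x _
      have h1 := (((hasDerivAt_id x).const_mul c).exp).div_const c
      refine h1.congr_deriv ?_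
      simp only [id, mul_one]
      field_simp)
    (Continuous.intervalIntegrable (by fun_prop) a b)
  rw [this]; ring


lemma bc_v {n : ℕ} (hn : 1 ≤ n) {m A B C : ℝ} (hm : 0 < m) (hm1 : m < 1)
    {u vr ut : ℝ → ℝ → ℝ} (h : Sol n m A B C u vr ut) {ε t s R : ℝ} (hε : A < ε) (ht : ε < t)
    (hts : t ≤ s) (hs : s < B) (hR : (s - ε) / (t - ε) ≤ R) {r : ℝ} (hr : 0 ≤ r) :
    u r s ^ m ≤ (R ^ (1 / (1 - m))) ^ m * u r t ^ m := by
  have h1 := benilan_crandall hn hm hm1 h hε ht hts hs r hr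
  have hp := h.pos r hr t ⟨by linarith, by linarith⟩
  have hp' := h.pos r hr s ⟨by linarith, by linarith⟩
  have h0 : 0 ≤ (s - ε) / (t - ε) := div_nonneg (by linarith) (by linarith)
  have h2 : ((s - ε) / (t - ε)) ^ (1 / (1 - m)) ≤ R ^ (1 / (1 - m)) :=
    Real.rpow_le_rpow h0 hR (one_div_nonneg.2 (by linarith))
  rw [← Real.mul_rpow (Real.rpow_nonneg (h0.trans hR) _) hp.le]
  exact Real.rpow_le_rpow hp'.le (h1.trans (mul_le_mul_of_nonneg_right h2 hp.le)) hm.le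

lemma inner_cont {n : ℕ} {m A B C : ℝ} {u vr ut : ℝ → ℝ → ℝ} (h : Sol n m A B C u vr ut)
    {t1 t2 : ℝ} (ht1 : t1 ∈ Ioo A B) (ht2 : t2 ∈ Ioo A B) :
    ContinuousOn (fun ρ => Real.sinh ρ ^ n * (u ρ t1 - u ρ t2)) (Ici 0) := by
  refine ContinuousOn.mul (by fun_prop) ((slice_r h.cu ht1).sub (slice_r h.cu ht2))

lemma outer_int {n : ℕ} {m A B C : ℝ} {u vr ut : ℝ → ℝ → ℝ} (h : Sol n m A B C u vr ut)
    {r1 r2 t1 t2 : ℝ} (hr1 : 0 < r1) (hr : r1 ≤ r2) (ht1 : t1 ∈ Ioo A B) (ht2 : t2 ∈ Ioo A B) :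
    IntervalIntegrable (fun r => (Real.sinh r ^ n)⁻¹ *
        ∫ ρ in (0:ℝ)..r, Real.sinh ρ ^ n * (u ρ t1 - u ρ t2)) volume r1 r2 := by
  apply ContinuousOn.intervalIntegrable_of_Icc hr
  refine ContinuousOn.mul (ContinuousOn.inv₀ (by fun_prop) ?_) ?_
  · intro x hx
    exact (pow_pos (Real.sinh_pos_iff.2 (hr1.trans_le hx.1)) n).ne'
  · have h2 : 0 ≤ r2 := hr1.le.trans hr
    have := intervalIntegral.continuousOn_primitive_interval (μ := volume) (a := 0) (b := r2)
      (f := fun ρ => Real.sinh ρ ^ n * (u ρ t1 - u ρ t2)) (by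
        rw [uIcc_of_le h2]
        exact ((inner_cont h ht1 ht2).mono (fun x hx => hx.1)).integrableOn_Icc)
    rw [uIcc_of_le h2] at this
    exact this.mono (fun x hx => ⟨hr1.le.trans hx.1, hx.2⟩)

def Dec (m A B : ℝ) (u : ℝ → ℝ → ℝ) (α : ℝ) : Prop :=
  ∀ t ∈ Ioo A B, ∃ D > 0, ∀ r ≥ (0:ℝ), u r t ^ m ≤ D * Real.exp (-α * r)

lemma Dec.mono {m A B : ℝ} {u : ℝ → ℝ → ℝ} {α α' : ℝ} (h : Dec m A B u α) (ha : α' ≤ α) :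
    Dec m A B u α' := by
  intro t ht
  obtain ⟨D, hD, hh⟩ := h t ht
  refine ⟨D, hD, fun r hr => (hh r hr).trans ?_⟩
  apply mul_le_mul_of_nonneg_left _ hD.le
  apply Real.exp_le_exp.2
  nlinarith

lemma dec_half {n : ℕ} {m A B C : ℝ} {u vr ut : ℝ → ℝ → ℝ} (h : Sol n m A B C u vr ut) :
    Dec m A B u ((n:ℝ) / 2) := by
  intro t ht
  exact extend_upper (slice_r (g := fun r t => u r t ^ m) h.cv ht) (by positivity)
    (fun r hr => decay_half h hr ht)

lemma V_tail {n : ℕ} {m A B C : ℝ} (hn : 1 ≤ n) {u vr ut : ℝ → ℝ → ℝ} (h : Sol n m A B C u vr ut)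
    {t1 t2 : ℝ} (ht1 : A < t1) (ht : t1 ≤ t2) (ht2 : t2 < B) :
    Tendsto (fun r => ∫ s in t1..t2, u r s ^ m) atTop (𝓝 0) := by
  have hT : ∀ t ∈ Icc t1 t2, t ∈ Ioo A B := fun t h => ⟨ht1.trans_le h.1, h.2.trans_lt ht2⟩
  have hlim : Tendsto (fun r : ℝ => (Real.sqrt (2 * C * 4 ^ n) * Real.exp (-((n:ℝ) / 2) * r)) *
      |t2 - t1|) atTop (𝓝 0) := by
    have : Tendsto (fun r : ℝ => Real.exp (-((n:ℝ) / 2) * r)) atTop (𝓝 0) := by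
      apply Real.tendsto_exp_atBot.comp
      have hn' : (0:ℝ) < n := by exact_mod_cast hn
      exact tendsto_id.const_mul_atTop_of_neg (by linarith)
    simpa using (this.const_mul (Real.sqrt (2 * C * 4 ^ n))).mul_const |t2 - t1|
  refine squeeze_zero_norm' ?_ hlim
  filter_upwards [eventually_ge_atTop (1:ℝ)] with r hr
  apply intervalIntegral.norm_integral_le_of_norm_le_const
  intro s hs
  rw [uIoc_of_le ht] at hs
  have hs' := hT s ⟨hs.1.le, hs.2⟩
  rw [Real.norm_of_nonneg (Real.rpow_nonneg (h.pos r (mem_Ici.2 (by linarith)) s hs').le _)]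
  exact decay_half h hr hs'

lemma dec_step {n : ℕ} (hn : 1 ≤ n) {m A B C : ℝ} (hm : 0 < m) (hm1 : m < 1)
    {u vr ut : ℝ → ℝ → ℝ} (h : Sol n m A B C u vr ut) {α β K : ℝ} (hd : Dec m A B u α)
    (hβ : 0 < β) (hK0 : 0 ≤ K)
    (hK : ∀ r ≥ (0:ℝ), ∫ ρ in (0:ℝ)..r, Real.exp (((n:ℝ) - α * (1 / m)) * ρ) ≤
      K * Real.exp (((n:ℝ) - β) * r)) : Dec m A B u β := by
  intro t2 ht2
  set ε := A + (t2 - A) / 3 with hε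
  set t1 := A + 2 * (t2 - A) / 3 with ht1
  have hA := ht2.1
  have hAε : A < ε := by linarith
  have hεt : ε < t1 := by linarith
  have ht : t1 < t2 := by linarith
  have ht1m : t1 ∈ Ioo A B := ⟨by linarith, by linarith [ht2.2]⟩
  have hT : ∀ t ∈ Icc t1 t2, t ∈ Ioo A B := fun t h =>
    ⟨ht1m.1.trans_le h.1, h.2.trans_lt ht2.2⟩
  obtain ⟨D, hD, hDb⟩ := hd t1 ht1m
  set D' := D ^ (1 / m) with hD'
  have hD'p : 0 < D' := Real.rpow_pos_of_pos hD _
  have hub : ∀ ρ ≥ (0:ℝ), u ρ t1 ≤ D' * Real.exp (-(α * (1 / m)) * ρ) := by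
    intro ρ hρ
    have hp := h.pos ρ hρ t1 ht1m
    have h1 : u ρ t1 = (u ρ t1 ^ m) ^ (1 / m) := by
      rw [← Real.rpow_mul hp.le, mul_one_div_cancel hm.ne', Real.rpow_one]
    rw [h1]
    refine (Real.rpow_le_rpow (Real.rpow_nonneg hp.le _) (hDb ρ hρ) (by positivity)).trans_eq ?_
    rw [Real.mul_rpow hD.le (Real.exp_pos _).le, ← Real.exp_mul, ← hD']
    congr 2
    ring
  have hin : ∀ r ≥ (0:ℝ), ∫ ρ in (0:ℝ)..r, Real.sinh ρ ^ n * (u ρ t1 - u ρ t2) ≤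
      D' * (K * Real.exp (((n:ℝ) - β) * r)) := by
    intro r hr
    refine le_trans ?_ (mul_le_mul_of_nonneg_left (hK r hr) hD'p.le)
    rw [← intervalIntegral.integral_const_mul]
    apply intervalIntegral.integral_mono_on hr
    · exact ((inner_cont h ht1m ht2).mono (fun x hx => hx.1)).intervalIntegrable_of_Icc hr
    · exact Continuous.intervalIntegrable (by fun_prop) _ _
    · intro ρ hρ
      have hp2 := h.pos ρ hρ.1 t2 ht2
      have hp1 := h.pos ρ hρ.1 t1 ht1m
      have hs0 : 0 ≤ Real.sinh ρ ^ n := pow_nonneg (Real.sinh_nonneg_iff.2 hρ.1) _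
      calc Real.sinh ρ ^ n * (u ρ t1 - u ρ t2) ≤ Real.sinh ρ ^ n * u ρ t1 :=
            mul_le_mul_of_nonneg_left (by linarith) hs0
        _ ≤ Real.exp ((n:ℝ) * ρ) * (D' * Real.exp (-(α * (1 / m)) * ρ)) :=
            mul_le_mul (sinh_pow_le n hρ.1) (hub ρ hρ.1) hp1.le (Real.exp_pos _).le
        _ = D' * Real.exp (((n:ℝ) - α * (1 / m)) * ρ) := by
            rw [mul_left_comm, ← Real.exp_add]; ring_nf
  set K1 := 4 ^ n * (D' * K) / β with hK1
  have hK10 : 0 ≤ K1 := by positivity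
  have hdiff : ∀ r1 ≥ (1:ℝ), ∀ r2 ≥ r1,
      (∫ s in t1..t2, u r1 s ^ m) - ∫ s in t1..t2, u r2 s ^ m ≤ K1 * Real.exp (-β * r1) := by
    intro r1 hr1 r2 hr
    rw [V_identity hn h (by linarith) hr ht1m.1 ht.le ht2.2]
    have : ∫ r in r1..r2, (Real.sinh r ^ n)⁻¹ *
        ∫ ρ in (0:ℝ)..r, Real.sinh ρ ^ n * (u ρ t1 - u ρ t2) ≤
        ∫ r in r1..r2, (4 ^ n * (D' * K)) * Real.exp (-β * r) := by
      apply intervalIntegral.integral_mono_on hr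
      · exact outer_int h (by linarith) hr ht1m ht2
      · exact Continuous.intervalIntegrable (by fun_prop) _ _
      · intro r hrr
        have hr1' : 1 ≤ r := hr1.trans hrr.1
        have hS : 0 < Real.sinh r ^ n := pow_pos (Real.sinh_pos_iff.2 (by linarith)) n
        calc _ ≤ (Real.sinh r ^ n)⁻¹ * (D' * (K * Real.exp (((n:ℝ) - β) * r))) :=
              mul_le_mul_of_nonneg_left (hin r (by linarith)) (inv_nonneg.2 hS.le)
          _ ≤ (4 ^ n * Real.exp (-(n:ℝ) * r)) * (D' * (K * Real.exp (((n:ℝ) - β) * r))) :=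
              mul_le_mul_of_nonneg_right (inv_sinh_pow_le n hr1') (by positivity)
          _ = (4 ^ n * (D' * K)) * (Real.exp (-(n:ℝ) * r) * Real.exp (((n:ℝ) - β) * r)) := by ring
          _ = _ := by rw [← Real.exp_add]; ring_nf
    refine this.trans ?_
    rw [intervalIntegral.integral_const_mul, int_exp (by linarith)]
    have e : (Real.exp (-β * r2) - Real.exp (-β * r1)) / -β =
      (Real.exp (-β * r1) - Real.exp (-β * r2)) / β := by field_simp; ring
    rw [e, hK1, mul_div_assoc', div_mul_eq_mul_div]
    apply div_le_div_of_nonneg_right _ hβ.le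
    apply mul_le_mul_of_nonneg_left _ (by positivity)
    linarith [Real.exp_pos (-β * r2)]
  have hV : ∀ r ≥ (1:ℝ), ∫ s in t1..t2, u r s ^ m ≤ K1 * Real.exp (-β * r) := by
    intro r hr
    have l1 := (V_tail hn h ht1m.1 ht.le ht2.2).const_sub (∫ s in t1..t2, u r s ^ m)
    rw [sub_zero] at l1
    refine le_of_tendsto l1 ?_
    filter_upwards [eventually_ge_atTop r] with r2 hr2
    exact hdiff r hr r2 hr2
  set R := (t2 - ε) / (t1 - ε) with hR
  have hRp : 0 < R := div_pos (by linarith) (by linarith)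
  set Q := (R ^ (1 / (1 - m))) ^ m with hQ
  have hQp : 0 < Q := Real.rpow_pos_of_pos (Real.rpow_pos_of_pos hRp _) _
  refine extend_upper (D := Q * K1 / (t2 - t1))
    (slice_r (g := fun r t => u r t ^ m) h.cv ht2) hβ.le ?_
  intro r hr
  have iv : IntervalIntegrable (fun s => u r s ^ m) volume t1 t2 :=
    ((slice_t (g := fun r t => u r t ^ m) h.cv (mem_Ici.2 (by linarith))).mono
      hT).intervalIntegrable_of_Icc ht.le
  have key : ∫ s in t1..t2, u r t2 ^ m ≤ ∫ s in t1..t2, Q * u r s ^ m := by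
    apply intervalIntegral.integral_mono_on ht.le (by simp) (iv.const_mul Q)
    intro s hs
    refine bc_v hn hm hm1 h hAε (hεt.trans_le hs.1) hs.2 ht2.2 ?_ (by linarith)
    apply div_le_div_of_nonneg_left <;> linarith [hs.1]
  rw [intervalIntegral.integral_const, intervalIntegral.integral_const_mul, smul_eq_mul] at key
  have := mul_le_mul_of_nonneg_left (hV r hr) hQp.le
  rw [div_mul_eq_mul_div, le_div_iff₀ (by linarith)]
  linarith

lemma dec_case1 {n : ℕ} (hn : 1 ≤ n) {m A B C : ℝ} (hm : 0 < m) (hm1 : m < 1)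
    {u vr ut : ℝ → ℝ → ℝ} (h : Sol n m A B C u vr ut) {α β : ℝ} (hd : Dec m A B u α)
    (hβ : 0 < β) (hβn : β < n) (hb : β ≤ α * (1 / m)) : Dec m A B u β := by
  have hc : 0 < (n:ℝ) - β := by linarith
  refine dec_step hn hm hm1 h (K := 1 / ((n:ℝ) - β)) hd hβ (by positivity) ?_
  intro r hr
  calc _ ≤ ∫ ρ in (0:ℝ)..r, Real.exp (((n:ℝ) - β) * ρ) := by
        apply intervalIntegral.integral_mono_on hr
        · exact Continuous.intervalIntegrable (by fun_prop) _ _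
        · exact Continuous.intervalIntegrable (by fun_prop) _ _
        · intro x hx
          exact Real.exp_le_exp.2 (mul_le_mul_of_nonneg_right (by linarith) hx.1)
    _ = (Real.exp (((n:ℝ) - β) * r) - Real.exp (((n:ℝ) - β) * 0)) / ((n:ℝ) - β) :=
        int_exp hc.ne' _ _
    _ ≤ _ := by
        rw [one_div_mul_eq_div]
        apply div_le_div_of_nonneg_right _ hc.le
        linarith [Real.exp_pos (((n:ℝ) - β) * 0)]

lemma dec_case2 {n : ℕ} (hn : 1 ≤ n) {m A B C : ℝ} (hm : 0 < m) (hm1 : m < 1)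
    {u vr ut : ℝ → ℝ → ℝ} (h : Sol n m A B C u vr ut) {α : ℝ} (hd : Dec m A B u α)
    (hb : (n:ℝ) < α * (1 / m)) : Dec m A B u n := by
  have hc : 0 < α * (1 / m) - n := by linarith
  have hn' : (0:ℝ) < n := by exact_mod_cast hn
  refine dec_step hn hm hm1 h (K := 1 / (α * (1 / m) - n)) hd hn' (by positivity) ?_
  intro r hr
  rw [int_exp (by linarith), sub_self, zero_mul, mul_zero, Real.exp_zero, mul_one]
  rw [show ((n:ℝ) - α * (1 / m)) = -(α * (1 / m) - n) by ring, div_neg, ← neg_div]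
  apply div_le_div_of_nonneg_right _ hc.le
  linarith [Real.exp_pos (-(α * (1 / m) - n) * r)]

lemma dec_n {n : ℕ} (hn : 1 ≤ n) {m A B C : ℝ} (hm : 0 < m) (hm1 : m < 1)
    {u vr ut : ℝ → ℝ → ℝ} (h : Sol n m A B C u vr ut) : Dec m A B u n := by
  have hn' : (0:ℝ) < n := by exact_mod_cast hn
  set θ := (1 + m) / 2 with hθ
  have hθ1 : θ < 1 := by linarith
  have hθ0 : 0 < θ := by linarith
  have hp : 1 < 1 / m := by rw [lt_div_iff₀ hm]; linarith
  have key : ∀ k : ℕ, Dec m A B u (min ((n:ℝ) / 2 * (1 / m) ^ k) (θ * n)) := by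
    intro k
    induction k with
    | zero => exact (dec_half h).mono (by simp)
    | succ k ih =>
      refine dec_case1 hn hm hm1 h ih (by positivity) ((min_le_right _ _).trans_lt (by nlinarith)) ?_
      rcases le_total ((n:ℝ) / 2 * (1 / m) ^ k) (θ * n) with hh | hh
      · rw [min_eq_left hh]
        refine (min_le_left _ _).trans ?_
        rw [pow_succ, mul_assoc]
      · rw [min_eq_right hh]
        refine (min_le_right _ _).trans ?_
        have : 0 < θ * n := by positivity
        nlinarith
  obtain ⟨k, hk⟩ := pow_unbounded_of_one_lt (θ * n / ((n:ℝ) / 2)) hp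
  rw [div_lt_iff₀ (by positivity)] at hk
  have h1 := key k
  rw [min_eq_right (by linarith)] at h1
  refine dec_case2 hn hm hm1 h h1 ?_
  rw [mul_one_div, lt_div_iff₀ hm]
  nlinarith

lemma lower {n : ℕ} (hn : 1 ≤ n) {m A B C : ℝ} (hm : 0 < m) (hm1 : m < 1)
    {u vr ut : ℝ → ℝ → ℝ} (h : Sol n m A B C u vr ut) {t1 : ℝ} (ht1 : t1 ∈ Ioo A B)
    (hex : ∀ r2 > (0:ℝ), ∃ T' ∈ Ioo t1 B, ∀ ρ ∈ Icc 0 r2, u ρ T' ≤ u ρ t1 / 2) :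
    ∃ D > 0, ∀ r ≥ (0:ℝ), D * Real.exp (-(n:ℝ) * r) ≤ u r t1 ^ m := by
  set M := ∫ ρ in (0:ℝ)..1, Real.sinh ρ ^ n * (u ρ t1 / 2) with hM
  have cM : ContinuousOn (fun ρ => Real.sinh ρ ^ n * (u ρ t1 / 2)) (Ici 0) :=
    ContinuousOn.mul (by fun_prop) ((slice_r h.cu ht1).div_const 2)
  have hMp : 0 < M := by
    apply intervalIntegral.intervalIntegral_pos_of_pos_on _ _ one_pos
    · exact (cM.mono (fun x hx => hx.1)).intervalIntegrable_of_Icc zero_le_one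
    · intro x hx
      exact mul_pos (pow_pos (Real.sinh_pos_iff.2 hx.1) _)
        (half_pos (h.pos x hx.1.le t1 ht1))
  set ε := (A + t1) / 2 with hε
  have hAε : A < ε := by linarith [ht1.1]
  have hεt : ε < t1 := by linarith [ht1.1]
  set R := (B - ε) / (t1 - ε) with hR
  have hRp : 0 < R := div_pos (by linarith [ht1.2]) (by linarith)
  set Q := (R ^ (1 / (1 - m))) ^ m with hQ
  have hQp : 0 < Q := Real.rpow_pos_of_pos (Real.rpow_pos_of_pos hRp _) _
  have hBt : 0 < B - t1 := by linarith [ht1.2]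
  have hn0 : (0:ℝ) ≤ n := Nat.cast_nonneg n
  refine extend_lower (D := Real.exp (-(n:ℝ)) * M / ((B - t1) * Q))
    (slice_r (g := fun r t => u r t ^ m) h.cv ht1)
    (fun r hr => Real.rpow_pos_of_pos (h.pos r hr t1 ht1) _) hn0 (by positivity) ?_
  intro r hr
  have hr0 : 0 ≤ r := by linarith
  obtain ⟨T', hT', hle⟩ := hex (r + 1) (by linarith)
  have hT'm : T' ∈ Ioo A B := ⟨ht1.1.trans hT'.1, hT'.2⟩
  have hT : ∀ t ∈ Icc t1 T', t ∈ Ioo A B := fun t h =>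
    ⟨ht1.1.trans_le h.1, h.2.trans_lt hT'.2⟩
  have hV := V_identity hn h (r1 := r) (r2 := r + 1) (by linarith) (by linarith) ht1.1 hT'.1.le hT'.2
  have hnn : 0 ≤ ∫ s in t1..T', u (r + 1) s ^ m :=
    intervalIntegral.integral_nonneg hT'.1.le (fun s hs =>
      Real.rpow_nonneg (h.pos (r+1) (mem_Ici.2 (by linarith)) s (hT s hs)).le _)
  have iv : IntervalIntegrable (fun s => u r s ^ m) volume t1 T' :=
    ((slice_t (g := fun r t => u r t ^ m) h.cv (mem_Ici.2 hr0)).mono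
      hT).intervalIntegrable_of_Icc hT'.1.le
  have hup : ∫ s in t1..T', u r s ^ m ≤ ∫ s in t1..T', Q * u r t1 ^ m := by
    apply intervalIntegral.integral_mono_on hT'.1.le iv (by simp)
    intro s hs
    refine bc_v hn hm hm1 h hAε hεt hs.1 (hT s hs).2 ?_ hr0
    exact div_le_div_of_nonneg_right (by linarith [(hT s hs).2]) (by linarith)
  rw [intervalIntegral.integral_const, smul_eq_mul] at hup
  have hup2 : (T' - t1) * (Q * u r t1 ^ m) ≤ (B - t1) * (Q * u r t1 ^ m) :=
    mul_le_mul_of_nonneg_right (by linarith [hT'.2])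
      (mul_nonneg hQp.le (Real.rpow_nonneg (h.pos r hr0 t1 ht1).le _))
  have hlow : ∫ x in r..(r+1), Real.exp (-(n:ℝ) * (r + 1)) * M ≤
      ∫ x in r..(r+1), (Real.sinh x ^ n)⁻¹ *
        ∫ ρ in (0:ℝ)..x, Real.sinh ρ ^ n * (u ρ t1 - u ρ T') := by
    apply intervalIntegral.integral_mono_on (by linarith) (by simp)
      (outer_int h (by linarith) (by linarith) ht1 hT'm)
    intro x hx
    have hx1 : 1 ≤ x := hr.trans hx.1
    have hS : 0 < Real.sinh x ^ n := pow_pos (Real.sinh_pos_iff.2 (by linarith)) n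
    have i1 : Real.exp (-(n:ℝ) * (r + 1)) ≤ (Real.sinh x ^ n)⁻¹ := by
      rw [neg_mul, Real.exp_neg]
      apply inv_anti₀ hS
      refine (sinh_pow_le n (by linarith)).trans (Real.exp_le_exp.2 ?_)
      exact mul_le_mul_of_nonneg_left hx.2 hn0
    have i2 : M ≤ ∫ ρ in (0:ℝ)..x, Real.sinh ρ ^ n * (u ρ t1 / 2) := by
      apply intervalIntegral.integral_mono_interval le_rfl zero_le_one hx1
      · filter_upwards [ae_restrict_mem measurableSet_Ioc] with y hy
        exact mul_nonneg (pow_nonneg (Real.sinh_nonneg_iff.2 hy.1.le) _)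
          (half_pos (h.pos y hy.1.le t1 ht1)).le
      · exact (cM.mono (fun x hx => hx.1)).intervalIntegrable_of_Icc (by linarith)
    have i3 : ∫ ρ in (0:ℝ)..x, Real.sinh ρ ^ n * (u ρ t1 / 2) ≤
        ∫ ρ in (0:ℝ)..x, Real.sinh ρ ^ n * (u ρ t1 - u ρ T') := by
      apply intervalIntegral.integral_mono_on (by linarith)
      · exact (cM.mono (fun x hx => hx.1)).intervalIntegrable_of_Icc (by linarith)
      · exact ((inner_cont h ht1 hT'm).mono
          (fun x hx => hx.1)).intervalIntegrable_of_Icc (by linarith)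
      · intro ρ hρ
        apply mul_le_mul_of_nonneg_left _ (pow_nonneg (Real.sinh_nonneg_iff.2 hρ.1) _)
        linarith [hle ρ ⟨hρ.1, hρ.2.trans hx.2⟩]
    exact mul_le_mul i1 (i2.trans i3) hMp.le (inv_nonneg.2 hS.le)
  rw [intervalIntegral.integral_const, smul_eq_mul, add_sub_cancel_left, one_mul] at hlow
  have e : Real.exp (-(n:ℝ) * (r + 1)) = Real.exp (-(n:ℝ)) * Real.exp (-(n:ℝ) * r) := by
    rw [← Real.exp_add]; ring_nf
  rw [e] at hlow
  rw [div_mul_eq_mul_div, div_le_iff₀ (by positivity)]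
  nlinarith

lemma ext_half {T t1 r2 : ℝ} {u : ℝ → ℝ → ℝ} (ht0 : 0 ≤ t1) (ht : t1 < T) (hr2 : 0 < r2)
    (hc : ContinuousOn (fun p : ℝ × ℝ => u p.1 p.2) (Ici 0 ×ˢ Icc 0 T))
    (hpos : ∀ r ∈ Ici (0:ℝ), 0 < u r t1) (h0 : ∀ r ∈ Ici (0:ℝ), u r T = 0) :
    ∃ T' ∈ Ioo t1 T, ∀ ρ ∈ Icc 0 r2, u ρ T' ≤ u ρ t1 / 2 := by
  have cs : ContinuousOn (fun r => u r t1) (Icc 0 r2) :=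
    hc.comp (f := fun r : ℝ => (r, t1)) (by fun_prop) (fun r hr => ⟨hr.1, ht0, ht.le⟩)
  obtain ⟨x, hx, hmin⟩ := (isCompact_Icc (a := (0:ℝ)) (b := r2)).exists_isMinOn
    (nonempty_Icc.2 hr2.le) cs
  have hxp := hpos x hx.1
  have hu := ((isCompact_Icc (a := (0:ℝ)) (b := r2)).prod
    (isCompact_Icc (a := t1) (b := T))).uniformContinuousOn_of_continuous
    (hc.mono (fun p hp => ⟨hp.1.1, ht0.trans hp.2.1, hp.2.2⟩))
  rw [Metric.uniformContinuousOn_iff] at hu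
  obtain ⟨δ, hδ, hh⟩ := hu (u x t1 / 2) (half_pos hxp)
  refine ⟨max ((t1 + T) / 2) (T - δ / 2), ⟨lt_max_of_lt_left (by linarith),
    max_lt (by linarith) (by linarith)⟩, ?_⟩
  intro ρ hρ
  set T' := max ((t1 + T) / 2) (T - δ / 2) with hT'
  have a1 : T - δ / 2 ≤ T' := le_max_right _ _
  have a2 : (t1 + T) / 2 ≤ T' := le_max_left _ _
  have a3 : T' < T := max_lt (by linarith) (by linarith)
  have := hh (ρ, T') ⟨hρ, by linarith, a3.le⟩ (ρ, T) ⟨hρ, ht.le, le_rfl⟩ (by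
    rw [Prod.dist_eq, dist_self, Real.dist_eq, abs_of_neg (by linarith)]
    exact max_lt hδ (by linarith))
  simp only [h0 ρ hρ.1, Real.dist_eq, sub_zero] at this
  have h1 := le_abs_self (u ρ T')
  have h2 : u x t1 ≤ u ρ t1 := hmin hρ
  linarith

/-- Two-sided spatial bounds at any fixed time, for subcritical exponents `m ∈ (0, m_s]`. -/
theorem subcritical_spatial_behaviour
    (N : ℕ) (hN : 3 ≤ N) (m T : ℝ)
    (hm : m ∈ Set.Ioc (0:ℝ) (((N : ℝ) - 2) / ((N : ℝ) + 2))) (hT : 0 < T)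
    (u : ℝ → ℝ → ℝ) (hu : IsRadialEnergySolution N m T u) :
    ∀ t ∈ Set.Ioo (0:ℝ) T, ∃ c₁ > (0:ℝ), ∃ c₂ > (0:ℝ), ∀ r ∈ Set.Ici (0:ℝ),
      c₁ * Real.exp (-((N : ℝ) - 1) * r / m) ≤ u r t ∧
      u r t ≤ c₂ * Real.exp (-((N : ℝ) - 1) * r / m) := by
  have hN' : (3:ℝ) ≤ N := by exact_mod_cast hN
  have hm0 : 0 < m := hm.1
  have hm1 : m < 1 := hm.2.trans_lt (by rw [div_lt_one (by linarith)]; linarith)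
  have hcast : ((N - 1 : ℕ) : ℝ) = (N : ℝ) - 1 := by
    rw [Nat.cast_sub (by omega), Nat.cast_one]
  intro t ht
  obtain ⟨C, vr, ut, h⟩ := exists_sol N hN m T u hu (A := t / 2)
    ⟨by linarith [ht.1], by linarith [ht.1, ht.2]⟩
  have htm : t ∈ Ioo (t / 2) T := ⟨by linarith [ht.1], ht.2⟩
  have hn : 1 ≤ N - 1 := by omega
  obtain ⟨D2, hD2, h2⟩ := dec_n hn hm0 hm1 h t htm
  obtain ⟨D1, hD1, h1⟩ := lower hn hm0 hm1 h htm (fun r2 hr2 =>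
    ext_half ht.1.le ht.2 hr2 hu.continuousOn (fun r hr => hu.pos r hr t ht) hu.extinction)
  rw [hcast] at h1 h2
  have hpw : ∀ D > (0:ℝ), ∀ r : ℝ, (D * Real.exp (-((N : ℝ) - 1) * r)) ^ (1 / m) =
      D ^ (1 / m) * Real.exp (-((N : ℝ) - 1) * r / m) := by
    intro D hD r
    rw [Real.mul_rpow hD.le (Real.exp_pos _).le, ← Real.exp_mul, mul_one_div]
  refine ⟨D1 ^ (1 / m), Real.rpow_pos_of_pos hD1 _, D2 ^ (1 / m), Real.rpow_pos_of_pos hD2 _, ?_⟩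
  intro r hr
  have hp := hu.pos r hr t ht
  have e : u r t = (u r t ^ m) ^ (1 / m) := by
    rw [← Real.rpow_mul hp.le, mul_one_div_cancel hm0.ne', Real.rpow_one]
  rw [← hpw D1 hD1, ← hpw D2 hD2, e]
  exact ⟨Real.rpow_le_rpow (by positivity) (h1 r hr) (by positivity),
    Real.rpow_le_rpow (Real.rpow_nonneg hp.le _) (h2 r hr) (by positivity)⟩
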